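/- arXiv:2003.01145 — 2 statements merged into one kernel-verified Lean document; each statement's English description precedes it below -/
import Mathlib

section
/- Let V be a finite-dimensional Γ-graded vector space with non-degenerate ε-symmetric bilinear form (·,·). For each n (with char(k)=0 or n<char(k)), the bilinear form on Λ^n_ε(V) defined by (u_1⊗…⊗u_n, v_1⊗…⊗v_n)_Λ = Σ_{σ∈S_n} B(π(σ)(u_1⊗…⊗u_n), v_1⊗…⊗v_n), where B(u_1⊗…⊗u_n, v_1⊗…⊗v_n) = ∏_{i=0}^{n-1} (u_{n-i}, v_{1+i}), descends to Λ^n_ε(V), is ε-symmetric and non-degenerate. -/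
open scoped BigOperators TensorProduct

/-- A commutation factor on an abelian group `Γ` with values in a field `k`. -/
structure CommFactor (k : Type) [Field k] (Γ : Type) [AddCommGroup Γ] : Type where
  eps : Γ → Γ → k
  eps_symm : ∀ a b, eps a b * eps b a = 1
  eps_add_left : ∀ a b c, eps (a + b) c = eps a c * eps b c
  eps_add_right : ∀ a b c, eps a (b + c) = eps a b * eps a c

/-- The cocycle `p(σ; v₁,…,vₙ)` of the sign-twisted action of `Sₙ` on `V^{⊗n}`,
expressed in terms of the degrees `d i` of the homogeneous vectors. -/
noncomputable def cocycle {k : Type} [Field k] {Γ : Type} [AddCommGroup Γ]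
    (E : CommFactor k Γ) {n : ℕ} (σ : Equiv.Perm (Fin n)) (d : Fin n → Γ) : k :=
  ((Equiv.Perm.sign σ : ℤ) : k) *
    ∏ x ∈ Finset.univ.filter
        (fun x : Fin n × Fin n => x.1 < x.2 ∧ σ⁻¹ x.2 < σ⁻¹ x.1),
      E.eps (d x.1) (d x.2)

/-- The defining relations of the `ε`-Clifford algebra of `(V, P)`.
Taking `P = 0` yields the `ε`-exterior algebra. -/
inductive CliffRel {k Γ V : Type} [Field k] [AddCommGroup Γ] [AddCommGroup V] [Module k V]
    (E : CommFactor k Γ) (𝒱 : Γ → Submodule k V) (P : V →ₗ[k] V →ₗ[k] k) :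
    TensorAlgebra k V → TensorAlgebra k V → Prop
  | mk (a b : Γ) (x y : V) (hx : x ∈ 𝒱 a) (hy : y ∈ 𝒱 b) :
      CliffRel E 𝒱 P
        (TensorAlgebra.ι k x * TensorAlgebra.ι k y
          + E.eps a b • (TensorAlgebra.ι k y * TensorAlgebra.ι k x))
        ((2 * P x y) • (1 : TensorAlgebra k V))

/-- The `ε`-Clifford algebra `C_ε(V, P)`; for `P = 0` this is the `ε`-exterior algebra. -/
abbrev Cliff {k Γ V : Type} [Field k] [AddCommGroup Γ] [AddCommGroup V] [Module k V]
    (E : CommFactor k Γ) (𝒱 : Γ → Submodule k V) (P : V →ₗ[k] V →ₗ[k] k) :=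
  RingQuot (CliffRel E 𝒱 P)

/-- The canonical image of `v : V` in the `ε`-Clifford algebra. -/
noncomputable def cl {k Γ V : Type} [Field k] [AddCommGroup Γ] [AddCommGroup V] [Module k V]
    (E : CommFactor k Γ) (𝒱 : Γ → Submodule k V) (P : V →ₗ[k] V →ₗ[k] k) (v : V) :
    Cliff E 𝒱 P :=
  RingQuot.mkAlgHom k (CliffRel E 𝒱 P) (TensorAlgebra.ι k v)

/-- The product `v₁ ⋯ vₙ` in the `ε`-Clifford algebra. -/
noncomputable def clProd {k Γ V : Type} [Field k] [AddCommGroup Γ] [AddCommGroup V] [Module k V]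
    (E : CommFactor k Γ) (𝒱 : Γ → Submodule k V) (P : V →ₗ[k] V →ₗ[k] k)
    {n : ℕ} (v : Fin n → V) : Cliff E 𝒱 P :=
  (List.ofFn fun i => cl E 𝒱 P (v i)).prod

/-- The `n`-th `ε`-exterior power `Λ^n_ε(V)`, as a subspace of the `ε`-exterior algebra. -/
noncomputable def extPow {k Γ V : Type} [Field k] [AddCommGroup Γ] [AddCommGroup V] [Module k V]
    (E : CommFactor k Γ) (𝒱 : Γ → Submodule k V) (n : ℕ) :
    Submodule k (Cliff E 𝒱 (0 : V →ₗ[k] V →ₗ[k] k)) :=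
  Submodule.span k {z | ∃ v : Fin n → V, z = clProd E 𝒱 0 v}

/-- The wedge `v₁ ∧ ⋯ ∧ vₙ` as an element of `Λ^n_ε(V)`. -/
noncomputable def extGen {k Γ V : Type} [Field k] [AddCommGroup Γ] [AddCommGroup V] [Module k V]
    (E : CommFactor k Γ) (𝒱 : Γ → Submodule k V) {n : ℕ} (v : Fin n → V) :
    ↥(extPow E 𝒱 n) :=
  ⟨clProd E 𝒱 0 v, Submodule.subset_span ⟨v, rfl⟩⟩


namespace ExtForm

section basic
variable {k : Type} [Field k] {Γ : Type} [AddCommGroup Γ] (E : CommFactor k Γ)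

theorem eps_ne (a b : Γ) : E.eps a b ≠ 0 := by
  intro h
  have := E.eps_symm a b
  rw [h, zero_mul] at this
  exact zero_ne_one this

theorem eps_zero_left (a : Γ) : E.eps 0 a = 1 := by
  have h := E.eps_add_left 0 0 a
  rw [add_zero] at h
  have := eps_ne E 0 a
  field_simp at h
  exact h.symm

theorem eps_zero_right (a : Γ) : E.eps a 0 = 1 := by
  have h := E.eps_symm a 0
  rwa [eps_zero_left, mul_one] at h

theorem eps_neg_left (a b : Γ) : E.eps (-a) b = E.eps b a := by
  have h := E.eps_add_left (-a) a b
  rw [neg_add_cancel, eps_zero_left] at h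
  have h2 := E.eps_symm a b
  have := eps_ne E a b
  apply mul_right_cancel₀ this
  rw [← h, mul_comm, h2]

theorem eps_neg_right (a b : Γ) : E.eps a (-b) = E.eps b a := by
  have h := E.eps_symm a (-b)
  rw [eps_neg_left] at h
  have h2 := E.eps_symm b a
  have := eps_ne E a b
  apply mul_right_cancel₀ this
  rw [h, h2]

theorem eps_neg_neg (a b : Γ) : E.eps (-a) (-b) = E.eps a b := by
  rw [eps_neg_left, eps_neg_left]

theorem eps_sum_left {ι : Type} (s : Finset ι) (f : ι → Γ) (c : Γ) :
    E.eps (∑ i ∈ s, f i) c = ∏ i ∈ s, E.eps (f i) c := by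
  classical
  induction s using Finset.induction_on with
  | empty => simp [eps_zero_left]
  | insert a s ha ih => rw [Finset.sum_insert ha, Finset.prod_insert ha, E.eps_add_left, ih]

theorem eps_sum_self {ι : Type} (s : Finset ι) (f : ι → Γ) :
    E.eps (∑ i ∈ s, f i) (∑ i ∈ s, f i) = ∏ i ∈ s, E.eps (f i) (f i) := by
  classical
  induction s using Finset.induction_on with
  | empty => simp [eps_zero_left]
  | insert a s ha ih =>
    rw [Finset.sum_insert ha, Finset.prod_insert ha, E.eps_add_left, E.eps_add_right,
      E.eps_add_right, ih]
    have := E.eps_symm (f a) (∑ i ∈ s, f i)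
    linear_combination (E.eps (f a) (f a) * ∏ i ∈ s, E.eps (f i) (f i)) * this

theorem cocycle_one {n : ℕ} (d : Fin n → Γ) : cocycle E 1 d = 1 := by
  unfold cocycle
  rw [Finset.prod_eq_one]
  · simp
  · intro x hx
    simp only [Finset.mem_filter, inv_one, Equiv.Perm.one_apply] at hx
    exact absurd hx.2.1 (not_lt.mpr hx.2.2.le)

theorem swap_lt {n : ℕ} (j : ℕ) (hj : j + 1 < n) (x y : Fin n)
    (h0 : ¬ (x.1 = j ∧ y.1 = j + 1)) (h1 : ¬ (x.1 = j + 1 ∧ y.1 = j)) :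
    Equiv.swap (⟨j, by omega⟩ : Fin n) ⟨j + 1, hj⟩ x
      < Equiv.swap (⟨j, by omega⟩ : Fin n) ⟨j + 1, hj⟩ y ↔ x < y := by
  simp only [Equiv.swap_apply_def, Fin.ext_iff, Fin.lt_def]
  split_ifs <;> simp_all <;> omega

theorem cocycle_swap_mul {n : ℕ} (j : ℕ) (hj : j + 1 < n) (τ : Equiv.Perm (Fin n))
    (d : Fin n → Γ) :
    cocycle E (Equiv.swap (⟨j, by omega⟩ : Fin n) ⟨j + 1, hj⟩ * τ) d
      = -(E.eps (d ⟨j, by omega⟩) (d ⟨j + 1, hj⟩)) *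
        cocycle E τ (d ∘ Equiv.swap (⟨j, by omega⟩ : Fin n) ⟨j + 1, hj⟩) := by
  set a : Fin n := ⟨j, by omega⟩ with ha
  set b : Fin n := ⟨j + 1, hj⟩ with hb
  have hab : a ≠ b := by simp [ha, hb]
  have hlt : a < b := by simp [ha, hb, Fin.lt_def]
  set s := Equiv.swap a b with hs
  have hsinv : s⁻¹ = s := Equiv.swap_inv a b
  have hsa : s a = b := Equiv.swap_apply_left a b
  have hsb : s b = a := Equiv.swap_apply_right a b
  have hss : ∀ x, s (s x) = x := fun x => by simp [hs]
  unfold cocycle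
  have hsign : ((Equiv.Perm.sign (s * τ) : ℤ) : k) = -((Equiv.Perm.sign τ : ℤ) : k) := by
    rw [Equiv.Perm.sign_mul, hs, Equiv.Perm.sign_swap hab]; simp
  rw [hsign, Finset.prod_filter, Finset.prod_filter]
  set f : Fin n × Fin n → k := fun x =>
    if x.1 < x.2 ∧ (s * τ)⁻¹ x.2 < (s * τ)⁻¹ x.1 then E.eps (d x.1) (d x.2) else 1 with hf
  set g : Fin n × Fin n → k := fun x =>
    if x.1 < x.2 ∧ τ⁻¹ x.2 < τ⁻¹ x.1 then E.eps ((d ∘ s) x.1) ((d ∘ s) x.2) else 1 with hg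
  have hinv : ∀ x, (s * τ)⁻¹ x = τ⁻¹ (s x) := by
    intro x; rw [mul_inv_rev, hsinv]; rfl
  have key : ∀ p : Fin n × Fin n, f p * (if p = (b, a) then g (a, b) else 1)
      = g ((Equiv.prodCongr s s) p) * (if p = (a, b) then f (a, b) else 1) := by
    rintro ⟨x, y⟩
    by_cases h0 : (x, y) = (a, b)
    · rw [h0]
      have : ¬ ((a, b) = (b, a)) := by simp [hab]
      have hgz : g (b, a) = 1 := by
        simp only [hg]; rw [if_neg]; intro h; exact absurd h.1 (not_lt.mpr hlt.le)
      rw [if_neg this, if_pos rfl]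
      simp only [Equiv.prodCongr_apply, Prod.map, hsa, hsb, hgz]
      ring
    · by_cases h1 : (x, y) = (b, a)
      · rw [h1]
        have : ¬ ((b, a) = (a, b)) := by simp [hab.symm]
        have hfz : f (b, a) = 1 := by
          simp only [hf]; rw [if_neg]; intro h; exact absurd h.1 (not_lt.mpr hlt.le)
        rw [if_pos rfl, if_neg this, hfz]
        simp only [Equiv.prodCongr_apply, Prod.map, hsa, hsb]
        ring
      · rw [if_neg h0, if_neg h1, mul_one, mul_one]
        simp only [hf, hg, Equiv.prodCongr_apply, Prod.map, Function.comp, hss, hinv]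
        have := swap_lt j hj x y (by
          rintro ⟨h, h'⟩; exact h0 (by simp [ha, hb, Fin.ext_iff, h, h'])) (by
          rintro ⟨h, h'⟩; exact h1 (by simp [ha, hb, Fin.ext_iff, h, h']))
        simp only [show (s x < s y) ↔ x < y from this]
  have hprod := Finset.prod_congr (rfl : (Finset.univ : Finset (Fin n × Fin n)) = _)
    (fun p _ => key p)
  rw [Finset.prod_mul_distrib, Finset.prod_mul_distrib, Finset.prod_ite_eq' ,
    Finset.prod_ite_eq', if_pos (Finset.mem_univ _), if_pos (Finset.mem_univ _),
    Equiv.prod_comp (Equiv.prodCongr s s) g] at hprod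
  have hgne : g (a, b) ≠ 0 := by
    simp only [hg]; split_ifs
    · exact eps_ne E _ _
    · exact one_ne_zero
  have hfg : f (a, b) = g (a, b) * E.eps (d a) (d b) := by
    simp only [hf, hg, hinv, hsa, hsb, Function.comp, hlt, true_and]
    rcases lt_or_gt_of_ne (τ⁻¹.injective.ne hab) with h | h
    · rw [if_pos h, if_neg (not_lt.mpr h.le), one_mul]
    · rw [if_pos h, if_neg (not_lt.mpr h.le), E.eps_symm]
  have hfin : ∏ p, f p = (∏ p, g p) * E.eps (d a) (d b) := by
    apply mul_right_cancel₀ hgne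
    rw [hprod, hfg]; ring
  rw [hfin]; ring

end basic

section sym
variable {k Γ V : Type} [Field k] [AddCommGroup Γ] [AddCommGroup V] [Module k V]
    (E : CommFactor k Γ) (𝒱 : Γ → Submodule k V) (P : V →ₗ[k] V →ₗ[k] k)

/-- The explicit formula. -/
noncomputable def S {n : ℕ} (u v : Fin n → V) (d : Fin n → Γ) : k :=
  ∑ σ : Equiv.Perm (Fin n), cocycle E σ d * ∏ i, P (u (σ i.rev)) (v i)

theorem S_swap {n : ℕ} (j : ℕ) (hj : j + 1 < n) (u v : Fin n → V) (d : Fin n → Γ) :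
    S E P u v d = -(E.eps (d ⟨j, by omega⟩) (d ⟨j + 1, hj⟩)) *
      S E P (u ∘ Equiv.swap (⟨j, by omega⟩ : Fin n) ⟨j + 1, hj⟩) v
        (d ∘ Equiv.swap (⟨j, by omega⟩ : Fin n) ⟨j + 1, hj⟩) := by
  unfold S
  rw [← Equiv.sum_comp (Equiv.mulLeft (Equiv.swap (⟨j, by omega⟩ : Fin n) ⟨j + 1, hj⟩)),
    Finset.mul_sum]
  refine Finset.sum_congr rfl fun σ _ => ?_
  rw [Equiv.coe_mulLeft, cocycle_swap_mul, mul_assoc]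
  rfl

theorem cocycle_dual {n : ℕ} (σ : Equiv.Perm (Fin n)) (du dv : Fin n → Γ)
    (h : ∀ i, dv i = - du (σ i.rev)) :
    cocycle E (Fin.revPerm * σ⁻¹ * Fin.revPerm) dv = cocycle E σ du := by
  unfold cocycle
  congr 1
  · congr 2
    rw [Equiv.Perm.sign_mul, Equiv.Perm.sign_mul, Equiv.Perm.sign_inv, mul_comm, ← mul_assoc]
    simp
  · have e1 : (Fin.revPerm * σ⁻¹ * Fin.revPerm : Equiv.Perm (Fin n))⁻¹
        = Fin.revPerm * σ * Fin.revPerm := by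
      ext x; simp [mul_inv_rev, mul_assoc, Equiv.Perm.inv_def]
    rw [e1, Finset.prod_filter, Finset.prod_filter]
    refine Eq.trans ?_
      (Equiv.prod_comp (Equiv.prodCongr (Fin.revPerm.trans σ) (Fin.revPerm.trans σ)) _)
    refine Finset.prod_congr rfl fun p _ => ?_
    obtain ⟨x, y⟩ := p
    simp only [Equiv.prodCongr_apply, Prod.map, Equiv.trans_apply, Fin.revPerm_apply,
      Equiv.Perm.mul_apply, Equiv.Perm.inv_def, Equiv.symm_apply_apply, h, eps_neg_neg, Fin.rev_lt_rev]
    simp only [and_comm]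

theorem S_symm {n : ℕ}
    (hPsymm : ∀ a b : Γ, ∀ v ∈ 𝒱 a, ∀ w ∈ 𝒱 b, P v w = E.eps a b * P w v)
    (hPdeg : ∀ a b : Γ, a + b ≠ 0 → ∀ v ∈ 𝒱 a, ∀ w ∈ 𝒱 b, P v w = 0)
    (u v : Fin n → V) (du dv : Fin n → Γ)
    (hu : ∀ i, u i ∈ 𝒱 (du i)) (hv : ∀ i, v i ∈ 𝒱 (dv i)) :
    S E P u v du = E.eps (∑ i, du i) (∑ i, dv i) * S E P v u dv := by
  unfold S
  rw [Finset.mul_sum]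
  let e : Equiv.Perm (Fin n) ≃ Equiv.Perm (Fin n) :=
    { toFun := fun σ => Fin.revPerm * σ⁻¹ * Fin.revPerm
      invFun := fun σ => Fin.revPerm * σ⁻¹ * Fin.revPerm
      left_inv := fun σ => by ext x; simp [mul_inv_rev, mul_assoc, Equiv.Perm.inv_def]
      right_inv := fun σ => by ext x; simp [mul_inv_rev, mul_assoc, Equiv.Perm.inv_def] }
  rw [← Equiv.sum_comp e (fun σ => E.eps (∑ i, du i) (∑ i, dv i) *
    (cocycle E σ dv * ∏ i, P (v (σ i.rev)) (u i)))]
  refine Finset.sum_congr rfl fun σ _ => ?_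
  change _ = _ * (cocycle E (Fin.revPerm * σ⁻¹ * Fin.revPerm) dv *
    ∏ i, P (v ((Fin.revPerm * σ⁻¹ * Fin.revPerm : Equiv.Perm (Fin n)) i.rev)) (u i))
  have hre : ∏ i, P (v ((Fin.revPerm * σ⁻¹ * Fin.revPerm : Equiv.Perm (Fin n)) i.rev)) (u i)
      = ∏ i, P (v i) (u (σ i.rev)) := by
    rw [← Equiv.prod_comp (Fin.revPerm.trans σ)]
    refine Finset.prod_congr rfl fun i _ => ?_
    simp [Equiv.Perm.mul_apply]
  rw [hre]
  by_cases h : ∀ i, dv i = - du (σ i.rev)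
  · rw [cocycle_dual E σ du dv h]
    have h1 : ∏ i, P (u (σ i.rev)) (v i)
        = (∏ i : Fin n, E.eps (du (σ i.rev)) (du (σ i.rev))) * ∏ i, P (v i) (u (σ i.rev)) := by
      rw [← Finset.prod_mul_distrib]
      refine Finset.prod_congr rfl fun i _ => ?_
      rw [hPsymm _ _ _ (hu _) _ (hv i), h i, eps_neg_right]
    have h2 : ∑ i, dv i = - ∑ i, du i := by
      rw [← Equiv.sum_comp (Fin.revPerm.trans σ) du, ← Finset.sum_neg_distrib]
      exact Finset.sum_congr rfl fun i _ => h i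
    have h3 : ∏ i : Fin n, E.eps (du (σ i.rev)) (du (σ i.rev)) = ∏ i, E.eps (du i) (du i) :=
      Equiv.prod_comp (Fin.revPerm.trans σ) (fun i => E.eps (du i) (du i))
    rw [h1, h2, eps_neg_right, eps_sum_self, h3]
    ring
  · push Not at h
    obtain ⟨i, hi⟩ := h
    have h1 : du (σ i.rev) + dv i ≠ 0 := fun h => hi (eq_neg_of_add_eq_zero_right h)
    have h2 : dv i + du (σ i.rev) ≠ 0 := by rwa [add_comm]
    rw [Finset.prod_eq_zero (Finset.mem_univ i) (hPdeg _ _ h1 _ (hu _) _ (hv _)),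
      Finset.prod_eq_zero (Finset.mem_univ i) (hPdeg _ _ h2 _ (hv _) _ (hu _))]
    simp

end sym

section alg

theorem ringQuot_vanish {k A W : Type} [Field k] [Ring A] [Algebra k A] [AddCommGroup W] [Module k W]
    (r : A → A → Prop) (f : A →ₗ[k] W)
    (h : ∀ x y, r x y → ∀ a b, f (a * (x - y) * b) = 0)
    (t : A) (ht : RingQuot.mkAlgHom k r t = 0) : f t = 0 := by
  let I : TwoSidedIdeal A := TwoSidedIdeal.mk' {t | ∀ a b, f (a * t * b) = 0}
    (by intro a b; simp)
    (by intro x y hx hy a b; rw [mul_add, add_mul, map_add, hx, hy, add_zero])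
    (by intro x hx a b; rw [mul_neg, neg_mul, map_neg, hx, neg_zero])
    (by intro x y hy a b; rw [← mul_assoc]; exact hy _ _)
    (by intro x y hx a b; rw [← mul_assoc, mul_assoc]; exact hx _ _)
  have hI : ∀ x, x ∈ I ↔ ∀ a b, f (a * x * b) = 0 := fun x => by
    simp only [I]; rw [TwoSidedIdeal.mem_mk']; rfl
  have hw : ∀ ⦃x y⦄, r x y → I.ringCon.mk' x = I.ringCon.mk' y := by
    intro x y hxy
    apply (RingCon.eq _).mpr
    rw [TwoSidedIdeal.rel_iff, hI]
    exact h x y hxy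
  have h1 : RingQuot.mkRingHom r t = 0 := by
    rw [← RingQuot.mkAlgHom_coe k r]; exact ht
  have h2 := RingQuot.lift_mkRingHom_apply I.ringCon.mk' hw t
  rw [h1, map_zero] at h2
  have h3 : t ∈ I := by
    rw [TwoSidedIdeal.mem_iff]
    exact (RingCon.eq _).mp (h2.symm.trans (map_zero I.ringCon.mk').symm)
  simpa using (hI t).mp h3 1 1

theorem ofFn_swap {α : Type} {n : ℕ} (j : ℕ) (hj : j + 1 < n) (u : Fin n → α) :
    ∃ l₁ l₂ : List α, l₁.length = j ∧
      List.ofFn u = l₁ ++ u ⟨j, by omega⟩ :: u ⟨j + 1, hj⟩ :: l₂ ∧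
      List.ofFn (u ∘ Equiv.swap (⟨j, by omega⟩ : Fin n) ⟨j + 1, hj⟩)
        = l₁ ++ u ⟨j + 1, hj⟩ :: u ⟨j, by omega⟩ :: l₂ := by
  refine ⟨(List.ofFn u).take j, (List.ofFn u).drop (j + 2), ?_, ?_, ?_⟩
  · simp; omega
  · conv_lhs => rw [← List.take_append_drop j (List.ofFn u)]
    congr 1
    rw [List.drop_eq_getElem_cons (by simp; omega), List.drop_eq_getElem_cons (by simp; omega)]
    simp
  · apply List.ext_getElem
    · simp; omega
    · intro i h1 h2
      rw [List.getElem_ofFn]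
      rw [List.getElem_append]
      simp only [Function.comp, Equiv.swap_apply_def, Fin.ext_iff]
      simp at h1
      have hmin : min j n = j := by omega
      simp only [List.length_take, List.length_ofFn, hmin]
      rcases lt_trichotomy i j with h | h | h
      · simp [h, h.ne, show ¬ i = j + 1 by omega]
      · subst h
        simp
      · obtain ⟨m, rfl⟩ : ∃ m, i = j + 1 + m := ⟨i - j - 1, by omega⟩
        rcases m with _ | m
        · simp [show j + 1 - j = 1 by omega]
        · simp [show j + 1 + (m + 1) - j = m + 2 by omega, show ¬ (j + 1 + (m + 1) < j) by omega,
            show ¬ (j + 1 + (m + 1) = j) by omega]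
          congr 1
          simp; omega

theorem word_basis {k V ι : Type} [Field k] [AddCommGroup V] [Module k V]
    (b : Module.Basis ι k V) (l : List ι) :
    b.tensorAlgebra (FreeMonoid.ofList l) = (l.map fun i => TensorAlgebra.ι k (b i)).prod := by
  rw [Module.Basis.tensorAlgebra, Module.Basis.map_apply, FreeAlgebra.basisFreeMonoid,
    Module.Basis.map_apply]
  apply (TensorAlgebra.equivFreeAlgebra b).injective
  apply FreeAlgebra.equivMonoidAlgebraFreeMonoid.injective
  simp only [AlgEquiv.toLinearEquiv_apply]
  simp
  induction l with
  | nil => simp [MonoidAlgebra.one_def]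
  | cons x l ih =>
    simp only [List.map_cons, List.prod_cons, map_mul]
    rw [← ih]
    simp [FreeAlgebra.equivMonoidAlgebraFreeMonoid, MonoidAlgebra.single_mul_single]

end alg

section words
set_option linter.unusedSectionVars false
variable {k V ι : Type} [Field k] [AddCommGroup V] [Module k V] [Fintype ι] [DecidableEq ι]
    (b : Module.Basis ι k V)

/-- The monomial of the tensor algebra attached to a list of basis indices. -/
noncomputable def word (l : List ι) : TensorAlgebra k V :=
  (l.map fun i => TensorAlgebra.ι k (b i)).prod

theorem word_append (l₁ l₂ : List ι) : word b (l₁ ++ l₂) = word b l₁ * word b l₂ := by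
  simp [word]

theorem word_cons (i : ι) (l : List ι) :
    word b (i :: l) = TensorAlgebra.ι k (b i) * word b l := by
  simp [word]

theorem mem_span_word (t : TensorAlgebra k V) : t ∈ Submodule.span k (Set.range (word b)) := by
  have h := b.tensorAlgebra.mem_span t
  have : Set.range b.tensorAlgebra = Set.range (word b) := by
    ext x
    constructor
    · rintro ⟨l, rfl⟩; exact ⟨FreeMonoid.toList l, (word_basis b _).symm⟩
    · rintro ⟨l, rfl⟩; exact ⟨FreeMonoid.ofList l, word_basis b _⟩
  rwa [this] at h

/-- The coefficients of the words of length `n`. -/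
noncomputable def coef (n : ℕ) : TensorAlgebra k V →ₗ[k] ((Fin n → ι) → k) :=
  LinearMap.pi fun w => (Finsupp.lapply (FreeMonoid.ofList (List.ofFn w))) ∘ₗ
    b.tensorAlgebra.repr.toLinearMap

theorem coef_word (n : ℕ) (l : List ι) (w : Fin n → ι) :
    coef b n (word b l) w = if l = List.ofFn w then 1 else 0 := by
  classical
  simp only [coef, LinearMap.pi_apply, LinearMap.comp_apply, LinearEquiv.coe_coe,
    Finsupp.lapply_apply]
  rw [word, ← word_basis, Module.Basis.repr_self, Finsupp.single_apply]
  simp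

theorem coef_word_ofFn {n : ℕ} (w : Fin n → ι) :
    coef b n (word b (List.ofFn w)) = Pi.single w 1 := by
  ext z
  rw [coef_word, Pi.single_apply]
  simp only [List.ofFn_inj, eq_comm]

theorem coef_word_ne {n : ℕ} (l : List ι) (h : l.length ≠ n) : coef b n (word b l) = 0 := by
  ext z
  rw [coef_word, if_neg]
  · rfl
  · rintro rfl; simp at h

theorem tprod_word {n : ℕ} (w : Fin n → ι) :
    TensorAlgebra.tprod k V n (fun i => b (w i)) = word b (List.ofFn w) := by
  rw [TensorAlgebra.tprod_apply, word, List.map_ofFn]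
  rfl

end words

section main
variable {k Γ V ι : Type} [Field k] [AddCommGroup Γ] [AddCommGroup V] [Module k V]
    [Fintype ι] [DecidableEq ι]
    (E : CommFactor k Γ) (𝒱 : Γ → Submodule k V) (P : V →ₗ[k] V →ₗ[k] k)
    (b : Module.Basis ι k V) (deg : ι → Γ)

/-- The quotient map. -/
noncomputable def qmap : TensorAlgebra k V →ₐ[k] Cliff E 𝒱 (0 : V →ₗ[k] V →ₗ[k] k) :=
  RingQuot.mkAlgHom k (CliffRel E 𝒱 0)

theorem clProd_eq {n : ℕ} (v : Fin n → V) :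
    clProd E 𝒱 0 v = qmap E 𝒱 (TensorAlgebra.tprod k V n v) := by
  rw [TensorAlgebra.tprod_apply, map_list_prod, List.map_ofFn]
  rfl

theorem coef_vanish {W : Type} [AddCommGroup W] [Module k W] {n : ℕ}
    (hspan : ∀ a, ∀ x ∈ 𝒱 a, x ∈ Submodule.span k {v | ∃ i, deg i = a ∧ b i = v})
    (g : ((Fin n → ι) → k) →ₗ[k] W)
    (hg : ∀ (w : Fin n → ι) (j : ℕ) (hj : j + 1 < n),
      g (Pi.single w 1) + E.eps (deg (w ⟨j, by omega⟩)) (deg (w ⟨j + 1, hj⟩)) •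
        g (Pi.single (w ∘ Equiv.swap (⟨j, by omega⟩ : Fin n) ⟨j + 1, hj⟩) 1) = 0)
    (t : TensorAlgebra k V) (ht : qmap E 𝒱 t = 0) : g (coef b n t) = 0 := by
  refine ringQuot_vanish (CliffRel E 𝒱 0) (g ∘ₗ coef b n) ?_ t ht
  rintro _ _ ⟨α, β, x, y, hx, hy⟩ a c
  simp only [LinearMap.zero_apply, mul_zero, zero_smul, sub_zero]
  induction mem_span_word b a using Submodule.span_induction with
  | zero => simp
  | add a a' _ _ h h' => rw [add_mul, add_mul, map_add, h, h', add_zero]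
  | smul r a _ h => rw [smul_mul_assoc, smul_mul_assoc, map_smul, h, smul_zero]
  | mem a ha =>
  obtain ⟨l₁, rfl⟩ := ha
  induction mem_span_word b c using Submodule.span_induction with
  | zero => simp
  | add a a' _ _ h h' => rw [mul_add, map_add, h, h', add_zero]
  | smul r a _ h => rw [mul_smul_comm, map_smul, h, smul_zero]
  | mem c hc =>
  obtain ⟨l₂, rfl⟩ := hc
  have hx' := hspan α x hx
  have hy' := hspan β y hy
  clear hx hy
  induction hx' using Submodule.span_induction with
  | zero => simp
  | add a a' _ _ h h' =>
    have : TensorAlgebra.ι k (a + a') * TensorAlgebra.ι k y +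
        E.eps α β • (TensorAlgebra.ι k y * TensorAlgebra.ι k (a + a'))
      = (TensorAlgebra.ι k a * TensorAlgebra.ι k y +
        E.eps α β • (TensorAlgebra.ι k y * TensorAlgebra.ι k a)) +
        (TensorAlgebra.ι k a' * TensorAlgebra.ι k y +
        E.eps α β • (TensorAlgebra.ι k y * TensorAlgebra.ι k a')) := by
      rw [map_add, add_mul, mul_add, smul_add]; abel
    rw [this, mul_add, add_mul, map_add, h, h', add_zero]
  | smul r a _ h =>
    have : TensorAlgebra.ι k (r • a) * TensorAlgebra.ι k y +
        E.eps α β • (TensorAlgebra.ι k y * TensorAlgebra.ι k (r • a))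
      = r • (TensorAlgebra.ι k a * TensorAlgebra.ι k y +
        E.eps α β • (TensorAlgebra.ι k y * TensorAlgebra.ι k a)) := by
      rw [map_smul, smul_mul_assoc, mul_smul_comm, smul_add, smul_comm]
    rw [this, mul_smul_comm, smul_mul_assoc, map_smul, h, smul_zero]
  | mem x hx =>
  obtain ⟨p, hp, rfl⟩ := hx
  induction hy' using Submodule.span_induction with
  | zero => simp
  | add a a' _ _ h h' =>
    have : TensorAlgebra.ι k (b p) * TensorAlgebra.ι k (a + a') +
        E.eps α β • (TensorAlgebra.ι k (a + a') * TensorAlgebra.ι k (b p))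
      = (TensorAlgebra.ι k (b p) * TensorAlgebra.ι k a +
        E.eps α β • (TensorAlgebra.ι k a * TensorAlgebra.ι k (b p))) +
        (TensorAlgebra.ι k (b p) * TensorAlgebra.ι k a' +
        E.eps α β • (TensorAlgebra.ι k a' * TensorAlgebra.ι k (b p))) := by
      rw [map_add, add_mul, mul_add, smul_add]; abel
    rw [this, mul_add, add_mul, map_add, h, h', add_zero]
  | smul r a _ h =>
    have : TensorAlgebra.ι k (b p) * TensorAlgebra.ι k (r • a) +
        E.eps α β • (TensorAlgebra.ι k (r • a) * TensorAlgebra.ι k (b p))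
      = r • (TensorAlgebra.ι k (b p) * TensorAlgebra.ι k a +
        E.eps α β • (TensorAlgebra.ι k a * TensorAlgebra.ι k (b p))) := by
      rw [map_smul, smul_mul_assoc, mul_smul_comm, smul_add, smul_comm]
    rw [this, mul_smul_comm, smul_mul_assoc, map_smul, h, smul_zero]
  | mem y hy =>
  obtain ⟨q, hq, rfl⟩ := hy
  have hrw : word b l₁ * (TensorAlgebra.ι k (b p) * TensorAlgebra.ι k (b q) +
      E.eps α β • (TensorAlgebra.ι k (b q) * TensorAlgebra.ι k (b p))) * word b l₂
      = word b (l₁ ++ p :: q :: l₂) + E.eps α β • word b (l₁ ++ q :: p :: l₂) := by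
    rw [word_append, word_append, word_cons, word_cons, word_cons, word_cons]
    simp only [mul_add, add_mul, mul_smul_comm, smul_mul_assoc, mul_assoc]
  rw [hrw, LinearMap.comp_apply]
  by_cases hl : (l₁ ++ p :: q :: l₂).length = n
  · subst hl
    have hj : l₁.length + 1 < (l₁ ++ p :: q :: l₂).length := by simp
    obtain ⟨m₁, m₂, hm, h1, h2⟩ := ofFn_swap l₁.length hj (l₁ ++ p :: q :: l₂).get
    have h3 := hg (l₁ ++ p :: q :: l₂).get l₁.length hj
    have e1 : (l₁ ++ p :: q :: l₂).get ⟨l₁.length, by simp⟩ = p := by simp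
    have e2 : (l₁ ++ p :: q :: l₂).get ⟨l₁.length + 1, hj⟩ = q := by simp
    rw [e1, e2] at h1 h2 h3
    rw [List.ofFn_get] at h1
    obtain ⟨rfl, h1'⟩ := List.append_inj h1 hm.symm
    simp only [List.cons.injEq, true_and] at h1'
    subst h1'
    have h4 := coef_word_ofFn b (l₁ ++ p :: q :: l₂).get
    rw [List.ofFn_get] at h4
    rw [← h2, map_add, map_smul, coef_word_ofFn, h4, map_add, map_smul, ← hp, ← hq]
    exact h3
  · rw [map_add, map_smul, coef_word_ne b _ hl, coef_word_ne b _ (by simpa using hl)]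
    simp

/-- The form on coefficient vectors. -/
noncomputable def Mform (n : ℕ) : ((Fin n → ι) → k) →ₗ[k] ((Fin n → ι) → k) →ₗ[k] k :=
  Matrix.toLinearMap₂' k (Matrix.of fun w z : Fin n → ι =>
    S E P (fun i => b (w i)) (fun i => b (z i)) (fun i => deg (w i)))

theorem Mform_single {n : ℕ} (w z : Fin n → ι) :
    Mform E P b deg n (Pi.single w 1) (Pi.single z 1)
      = S E P (fun i => b (w i)) (fun i => b (z i)) (fun i => deg (w i)) := by
  rw [Mform, Matrix.toLinearMap₂'_apply']
  simp

/-- The form on the tensor algebra. -/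
noncomputable def Phi (n : ℕ) : TensorAlgebra k V →ₗ[k] TensorAlgebra k V →ₗ[k] k :=
  (Mform E P b deg n).compl₁₂ (coef b n) (coef b n)

theorem Phi_word {n : ℕ} (w z : Fin n → ι) :
    Phi E P b deg n (word b (List.ofFn w)) (word b (List.ofFn z))
      = S E P (fun i => b (w i)) (fun i => b (z i)) (fun i => deg (w i)) := by
  simp only [Phi, LinearMap.compl₁₂_apply, coef_word_ofFn, Mform_single]

theorem Phi_left {n : ℕ}
    (hspan : ∀ a, ∀ x ∈ 𝒱 a, x ∈ Submodule.span k {v | ∃ i, deg i = a ∧ b i = v})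
    (t : TensorAlgebra k V) (ht : qmap E 𝒱 t = 0) : Phi E P b deg n t = 0 := by
  have h := coef_vanish E 𝒱 b deg hspan (Mform E P b deg n) (n := n) ?_ t ht
  · ext y
    simp only [Phi, LinearMap.compl₁₂_apply, h, LinearMap.zero_apply]
  · intro w j hj
    refine LinearMap.pi_ext' fun z => ?_
    ext
    simp only [LinearMap.comp_apply, LinearMap.add_apply, LinearMap.smul_apply,
      LinearMap.coe_single, Mform_single]
    rw [S_swap E P j hj]
    simp [Function.comp_def]

theorem Phi_right {n : ℕ}
    (hPsymm : ∀ a b : Γ, ∀ v ∈ 𝒱 a, ∀ w ∈ 𝒱 b, P v w = E.eps a b * P w v)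
    (hPdeg : ∀ a b : Γ, a + b ≠ 0 → ∀ v ∈ 𝒱 a, ∀ w ∈ 𝒱 b, P v w = 0)
    (hb : ∀ i, b i ∈ 𝒱 (deg i))
    (hspan : ∀ a, ∀ x ∈ 𝒱 a, x ∈ Submodule.span k {v | ∃ i, deg i = a ∧ b i = v})
    (t : TensorAlgebra k V) (ht : qmap E 𝒱 t = 0) : (Phi E P b deg n).flip t = 0 := by
  have h := coef_vanish E 𝒱 b deg hspan (Mform E P b deg n).flip (n := n) ?_ t ht
  · ext y
    have := LinearMap.congr_fun h (coef b n y)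
    exact this
  · intro w j hj
    refine LinearMap.pi_ext' fun z => ?_
    ext
    simp only [LinearMap.comp_apply, LinearMap.add_apply, LinearMap.smul_apply,
      LinearMap.flip_apply,
      LinearMap.coe_single, Mform_single]
    rw [S_symm E 𝒱 P hPsymm hPdeg (fun i => b (z i)) (fun i => b (w i)) _ (fun i => deg (w i))
      (fun i => hb _) (fun i => hb _),
      S_symm E 𝒱 P hPsymm hPdeg (fun i => b (z i)) _ _ (fun i => deg _)
      (fun i => hb _) (fun i => hb _), S_swap E P j hj]
    have hs : ∑ i, deg ((w ∘ Equiv.swap (⟨j, by omega⟩ : Fin n) ⟨j + 1, hj⟩) i)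
        = ∑ i, deg (w i) :=
      Equiv.sum_comp (Equiv.swap (⟨j, by omega⟩ : Fin n) ⟨j + 1, hj⟩) (fun i => deg (w i))
    rw [hs]
    simp [Function.comp_def]
    ring

theorem Phi_basis_left {n : ℕ} (w : Fin n → ι) (v : Fin n → V) :
    Phi E P b deg n (TensorAlgebra.tprod k V n (fun i => b (w i))) (TensorAlgebra.tprod k V n v)
      = S E P (fun i => b (w i)) v (fun i => deg (w i)) := by
  let L : MultilinearMap k (fun _ : Fin n => V) k :=
    (Phi E P b deg n (TensorAlgebra.tprod k V n (fun i => b (w i)))).compMultilinearMap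
      (TensorAlgebra.tprod k V n)
  let R : MultilinearMap k (fun _ : Fin n => V) k :=
    ∑ σ : Equiv.Perm (Fin n), cocycle E σ (fun i => deg (w i)) •
      (MultilinearMap.mkPiAlgebra k (Fin n) k).compLinearMap (fun i => P (b (w (σ i.rev))))
  have hR : ∀ v, R v = S E P (fun i => b (w i)) v (fun i => deg (w i)) := by
    intro v
    simp [R, S]
  have : L = R := by
    refine Module.Basis.ext_multilinear (fun _ => b) fun z => ?_
    rw [hR]
    change Phi E P b deg n _ (TensorAlgebra.tprod k V n (fun i => b (z i))) = _
    rw [tprod_word, tprod_word, Phi_word]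
  rw [← hR, ← this]
  rfl

theorem Phi_hom {n : ℕ}
    (hrepr : ∀ a, ∀ x ∈ 𝒱 a, ∀ i, deg i ≠ a → b.repr x i = 0)
    (u v : Fin n → V) (du : Fin n → Γ) (hu : ∀ i, u i ∈ 𝒱 (du i)) :
    Phi E P b deg n (TensorAlgebra.tprod k V n u) (TensorAlgebra.tprod k V n v)
      = S E P u v du := by
  have hexp : ∀ F : MultilinearMap k (fun _ : Fin n => V) k,
      F u = ∑ w : Fin n → ι, (∏ i, b.repr (u i) (w i)) * F (fun i => b (w i)) := by
    intro F
    have h1 : u = fun i => ∑ j, b.repr (u i) j • b j := by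
      ext i; exact (b.sum_repr (u i)).symm
    conv_lhs => rw [h1]
    rw [MultilinearMap.map_sum]
    refine Finset.sum_congr rfl fun w _ => ?_
    rw [MultilinearMap.map_smul_univ, smul_eq_mul]
  let L : MultilinearMap k (fun _ : Fin n => V) k :=
    ((Phi E P b deg n).flip (TensorAlgebra.tprod k V n v)).compMultilinearMap
      (TensorAlgebra.tprod k V n)
  let R : MultilinearMap k (fun _ : Fin n => V) k :=
    ∑ σ : Equiv.Perm (Fin n), cocycle E σ du •
      ((MultilinearMap.mkPiAlgebra k (Fin n) k).compLinearMap
        (fun i => P.flip (v i))).domDomCongr (Fin.revPerm.trans σ)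
  have hR : ∀ u, R u = S E P u v du := by
    intro u
    simp [R, S]
  change L u = _
  rw [← hR, hexp L, hexp R]
  refine Finset.sum_congr rfl fun w _ => ?_
  by_cases h : ∀ i, deg (w i) = du i
  · congr 1
    rw [hR]
    change Phi E P b deg n (TensorAlgebra.tprod k V n _) (TensorAlgebra.tprod k V n v) = _
    rw [Phi_basis_left]
    congr 1
    exact funext h
  · push Not at h
    obtain ⟨i, hi⟩ := h
    rw [Finset.prod_eq_zero (Finset.mem_univ i) (hrepr _ _ (hu i) _ hi), zero_mul, zero_mul]

theorem clProd_swap {n : ℕ} (j : ℕ) (hj : j + 1 < n) (u : Fin n → V) (d : Fin n → Γ)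
    (hu : ∀ i, u i ∈ 𝒱 (d i)) :
    clProd E 𝒱 0 u = -(E.eps (d ⟨j, by omega⟩) (d ⟨j + 1, hj⟩)) •
      clProd E 𝒱 0 (u ∘ Equiv.swap (⟨j, by omega⟩ : Fin n) ⟨j + 1, hj⟩) := by
  obtain ⟨l₁, l₂, -, h1, h2⟩ := ofFn_swap j hj (fun i => cl E 𝒱 0 (u i))
  have hrel : cl E 𝒱 0 (u ⟨j, by omega⟩) * cl E 𝒱 0 (u ⟨j + 1, hj⟩)
      = -(E.eps (d ⟨j, by omega⟩) (d ⟨j + 1, hj⟩)) •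
        (cl E 𝒱 0 (u ⟨j + 1, hj⟩) * cl E 𝒱 0 (u ⟨j, by omega⟩)) := by
    have := RingQuot.mkAlgHom_rel k (CliffRel.mk (E := E) (𝒱 := 𝒱) (P := 0) _ _ _ _
      (hu ⟨j, by omega⟩) (hu ⟨j + 1, hj⟩))
    simp only [LinearMap.zero_apply, mul_zero, zero_smul, map_zero, map_add, map_smul,
      map_mul] at this
    set A := cl E 𝒱 0 (u ⟨j, by omega⟩) * cl E 𝒱 0 (u ⟨j + 1, hj⟩) with hA
    set B := cl E 𝒱 0 (u ⟨j + 1, hj⟩) * cl E 𝒱 0 (u ⟨j, by omega⟩) with hB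
    set e := E.eps (d ⟨j, by omega⟩) (d ⟨j + 1, hj⟩)
    have this' : A + e • B = 0 := this
    calc A = A + (e + -e) • B := by rw [add_neg_cancel, zero_smul, add_zero]
      _ = (-e) • B := by rw [add_smul, ← add_assoc, this', zero_add]
  have e1 : clProd E 𝒱 0 u = l₁.prod * (cl E 𝒱 0 (u ⟨j, by omega⟩) *
      cl E 𝒱 0 (u ⟨j + 1, hj⟩)) * l₂.prod := by
    rw [clProd, h1]; simp [mul_assoc]
  have e2 : clProd E 𝒱 0 (u ∘ Equiv.swap (⟨j, by omega⟩ : Fin n) ⟨j + 1, hj⟩)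
      = l₁.prod * (cl E 𝒱 0 (u ⟨j + 1, hj⟩) * cl E 𝒱 0 (u ⟨j, by omega⟩)) * l₂.prod := by
    rw [clProd]
    change (List.ofFn ((fun i => cl E 𝒱 0 (u i)) ∘ _)).prod = _
    rw [h2]; simp [mul_assoc]
  rw [e1, e2, hrel, mul_smul_comm, smul_mul_assoc]

theorem clProd_perm {n : ℕ} (σ : Equiv.Perm (Fin n)) : ∀ (u : Fin n → V) (d : Fin n → Γ)
    (_ : ∀ i, u i ∈ 𝒱 (d i)),
    clProd E 𝒱 0 u = cocycle E σ d • clProd E 𝒱 0 (u ∘ σ) := by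
  rcases n with _ | n
  · intro u d hu
    have : σ = 1 := Subsingleton.elim _ _
    subst this
    rw [cocycle_one, one_smul]; rfl
  · have hσ : σ ∈ Submonoid.closure (Set.range fun i : Fin n ↦ Equiv.swap i.castSucc i.succ) := by
      rw [Equiv.Perm.mclosure_swap_castSucc_succ]; trivial
    induction hσ using Submonoid.closure_induction_left with
    | one => intro u d hu; rw [cocycle_one, one_smul]; rfl
    | mul_left s hs τ _ ih =>
      obtain ⟨i, rfl⟩ := hs
      intro u d hu
      have hj : i.1 + 1 < n + 1 := by omega
      have h1 := clProd_swap E 𝒱 i.1 hj u d hu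
      have h2 := cocycle_swap_mul E i.1 hj τ d
      have h3 := ih (u ∘ Equiv.swap (⟨i.1, by omega⟩ : Fin (n + 1)) ⟨i.1 + 1, hj⟩)
        (d ∘ Equiv.swap (⟨i.1, by omega⟩ : Fin (n + 1)) ⟨i.1 + 1, hj⟩) (fun _ => hu _)
      change _ = cocycle E (Equiv.swap (⟨i.1, by omega⟩ : Fin (n + 1)) ⟨i.1 + 1, hj⟩ * τ) d •
        clProd E 𝒱 0 ((u ∘ Equiv.swap (⟨i.1, by omega⟩ : Fin (n + 1)) ⟨i.1 + 1, hj⟩) ∘ τ)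
      rw [h2, h1, mul_smul, ← h3]

theorem clProd_mem {n : ℕ} (v : Fin n → V) :
    clProd E 𝒱 0 v ∈ Submodule.span k
      (Set.range fun w : Fin n → ι => clProd E 𝒱 0 (fun i => b (w i))) := by
  have h1 : v = fun i => ∑ j, b.repr (v i) j • b j := by
    ext i; exact (b.sum_repr (v i)).symm
  rw [clProd_eq, h1, MultilinearMap.map_sum, map_sum]
  refine Submodule.sum_mem _ fun w _ => ?_
  rw [MultilinearMap.map_smul_univ, map_smul, ← clProd_eq]
  exact Submodule.smul_mem _ _ (Submodule.subset_span ⟨w, rfl⟩)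

theorem nondeg {n : ℕ} (hn : (n.factorial : k) ≠ 0) (hb : ∀ i, b i ∈ 𝒱 (deg i))
    (b' : ι → V) (hb' : ∀ i j, P (b i) (b' j) = if i = j then 1 else 0)
    (c : (Fin n → ι) → k)
    (h : ∀ v : Fin n → V,
      ∑ w, c w * S E P (fun i => b (w i)) v (fun i => deg (w i)) = 0) :
    ∑ w, c w • clProd E 𝒱 0 (fun i => b (w i)) = 0 := by
  have hA : ∀ z : Fin n → ι, ∑ w : Fin n → ι, ∑ σ : Equiv.Perm (Fin n),
      (if w ∘ σ = z then c w * cocycle E σ (fun i => deg (w i)) else 0) = 0 := by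
    intro z
    refine Eq.trans ?_ (h (fun i => b' (z i.rev)))
    refine Finset.sum_congr rfl fun w _ => ?_
    rw [S, Finset.mul_sum]
    refine Finset.sum_congr rfl fun σ _ => ?_
    simp only [hb']
    rw [Finset.prod_ite_zero]
    have : (∀ i ∈ (Finset.univ : Finset (Fin n)), w (σ i.rev) = z i.rev) ↔ w ∘ σ = z := by
      constructor
      · intro h; ext i; simpa using h i.rev (Finset.mem_univ _)
      · rintro rfl i _; rfl
    simp only [this, Finset.prod_const_one, mul_ite, mul_one, mul_zero]
  have key : (n.factorial : k) • ∑ w, c w • clProd E 𝒱 0 (fun i => b (w i)) = 0 := by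
    have e : ∀ w : Fin n → ι, (n.factorial : k) • (c w • clProd E 𝒱 0 (fun i => b (w i)))
        = ∑ σ : Equiv.Perm (Fin n), ∑ z : Fin n → ι,
          (if w ∘ σ = z then c w * cocycle E σ (fun i => deg (w i)) else 0) •
            clProd E 𝒱 0 (fun i => b (z i)) := by
      intro w
      have : ∀ σ : Equiv.Perm (Fin n), ∑ z : Fin n → ι,
          (if w ∘ σ = z then c w * cocycle E σ (fun i => deg (w i)) else 0) •
            clProd E 𝒱 0 (fun i => b (z i)) = c w • clProd E 𝒱 0 (fun i => b (w i)) := by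
        intro σ
        simp only [ite_smul, zero_smul]
        rw [Finset.sum_ite_eq, if_pos (Finset.mem_univ _), mul_smul]
        congr 1
        exact (clProd_perm E 𝒱 σ (fun i => b (w i)) (fun i => deg (w i)) (fun i => hb _)).symm
      rw [Finset.sum_congr rfl fun σ _ => this σ, Finset.sum_const, Finset.card_univ,
        Fintype.card_perm, Fintype.card_fin, Nat.cast_smul_eq_nsmul]
    rw [Finset.smul_sum, Finset.sum_congr rfl fun w _ => e w]
    rw [Finset.sum_congr rfl fun w _ => Finset.sum_comm, Finset.sum_comm]
    refine Finset.sum_eq_zero fun z _ => ?_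
    rw [Finset.sum_congr rfl fun w _ => (Finset.sum_smul).symm, ← Finset.sum_smul, hA, zero_smul]
  exact (smul_eq_zero.mp key).resolve_left hn

end main

end ExtForm

/-- The bilinear form `(·,·)_Λ` on the `n`-th `ε`-exterior power `Λⁿ_ε(V)`:
it is given on wedges of homogeneous vectors by
`(u₁∧…∧uₙ, v₁∧…∧vₙ)_Λ = Σ_σ p(σ;u) ∏ᵢ (u_{σ(n-i)}, v_{1+i})`,
it is `ε`-symmetric and non-degenerate. -/
theorem extPow_form_exists {k Γ V : Type} [Field k] [AddCommGroup Γ] [DecidableEq Γ]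
    [AddCommGroup V] [Module k V] [FiniteDimensional k V]
    (E : CommFactor k Γ) (𝒱 : Γ → Submodule k V) (hint : DirectSum.IsInternal 𝒱)
    (P : V →ₗ[k] V →ₗ[k] k)
    (hPsymm : ∀ a b : Γ, ∀ v ∈ 𝒱 a, ∀ w ∈ 𝒱 b, P v w = E.eps a b * P w v)
    (hPdeg : ∀ a b : Γ, a + b ≠ 0 → ∀ v ∈ 𝒱 a, ∀ w ∈ 𝒱 b, P v w = 0)
    (hPnd : ∀ v : V, (∀ w : V, P v w = 0) → v = 0)
    (n : ℕ) (hn : (n.factorial : k) ≠ 0) :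
    ∃ β : ↥(extPow E 𝒱 n) →ₗ[k] ↥(extPow E 𝒱 n) →ₗ[k] k,
      (∀ (u v : Fin n → V) (du dv : Fin n → Γ),
          (∀ i, u i ∈ 𝒱 (du i)) → (∀ i, v i ∈ 𝒱 (dv i)) →
          β (extGen E 𝒱 u) (extGen E 𝒱 v)
            = ∑ σ : Equiv.Perm (Fin n),
                cocycle E σ du * ∏ i, P (u (σ i.rev)) (v i)) ∧
      (∀ (u v : Fin n → V) (du dv : Fin n → Γ),
          (∀ i, u i ∈ 𝒱 (du i)) → (∀ i, v i ∈ 𝒱 (dv i)) →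
          β (extGen E 𝒱 u) (extGen E 𝒱 v)
            = E.eps (∑ i, du i) (∑ i, dv i) * β (extGen E 𝒱 v) (extGen E 𝒱 u)) ∧
      (∀ x : ↥(extPow E 𝒱 n), (∀ y : ↥(extPow E 𝒱 n), β x y = 0) → x = 0) := by
  classical
  let bs := fun a => Module.Basis.ofVectorSpace k (𝒱 a)
  let b := hint.collectedBasis bs
  let deg : (Σ a, Module.Basis.ofVectorSpaceIndex k (𝒱 a)) → Γ := fun i => i.1
  have : Fintype (Σ a, Module.Basis.ofVectorSpaceIndex k (𝒱 a)) :=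
    FiniteDimensional.fintypeBasisIndex b
  have hb : ∀ i, b i ∈ 𝒱 (deg i) := fun i => hint.collectedBasis_mem bs i
  have hrepr : ∀ a, ∀ x ∈ 𝒱 a, ∀ i, deg i ≠ a → b.repr x i = 0 := by
    rintro a x hx ⟨a', i⟩ hi
    exact hint.collectedBasis_repr_of_mem_ne bs (Ne.symm hi) hx
  have hspan : ∀ a, ∀ x ∈ 𝒱 a, x ∈ Submodule.span k {v | ∃ i, deg i = a ∧ b i = v} := by
    intro a x hx
    rw [← b.sum_repr x]
    refine Submodule.sum_mem _ fun i _ => ?_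
    by_cases hi : deg i = a
    · exact Submodule.smul_mem _ _ (Submodule.subset_span ⟨i, hi, rfl⟩)
    · rw [hrepr a x hx i hi, zero_smul]; exact Submodule.zero_mem _
  have hsurj : Function.Surjective P.flip := by
    rw [LinearMap.flip_surjective_iff₁]
    rw [← LinearMap.ker_eq_bot, LinearMap.ker_eq_bot']
    intro v hv
    exact hPnd v fun w => by rw [hv]; rfl
  choose b' hb'' using fun j => hsurj (b.coord j)
  have hb' : ∀ i j, P (b i) (b' j) = if i = j then 1 else 0 := by
    intro i j
    have := LinearMap.congr_fun (hb'' j) (b i)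
    rw [LinearMap.flip_apply] at this
    rw [this, Module.Basis.coord_apply, Module.Basis.repr_self, Finsupp.single_apply]
  have hqs : Function.Surjective (ExtForm.qmap E 𝒱) := RingQuot.mkAlgHom_surjective k _
  obtain ⟨s, hs⟩ := (ExtForm.qmap E 𝒱).toLinearMap.exists_rightInverse_of_surjective
    (LinearMap.range_eq_top.mpr hqs)
  have hs' : ∀ x, ExtForm.qmap E 𝒱 (s x) = x := fun x => LinearMap.congr_fun hs x
  have hPhi : ∀ t t', ExtForm.Phi E P b deg n (s (ExtForm.qmap E 𝒱 t)) (s (ExtForm.qmap E 𝒱 t'))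
      = ExtForm.Phi E P b deg n t t' := by
    intro t t'
    have h1 := ExtForm.Phi_left (n := n) E 𝒱 P b deg hspan (s (ExtForm.qmap E 𝒱 t) - t)
      (by rw [map_sub, hs', sub_self])
    have h2 := ExtForm.Phi_right (n := n) E 𝒱 P b deg hPsymm hPdeg hb hspan
      (s (ExtForm.qmap E 𝒱 t') - t') (by rw [map_sub, hs', sub_self])
    rw [map_sub, sub_eq_zero] at h1 h2
    rw [h1]
    exact LinearMap.congr_fun h2 t
  let β : ↥(extPow E 𝒱 n) →ₗ[k] ↥(extPow E 𝒱 n) →ₗ[k] k :=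
    (ExtForm.Phi E P b deg n).compl₁₂ (s ∘ₗ (extPow E 𝒱 n).subtype) (s ∘ₗ (extPow E 𝒱 n).subtype)
  have hβ : ∀ u v : Fin n → V, β (extGen E 𝒱 u) (extGen E 𝒱 v)
      = ExtForm.Phi E P b deg n (TensorAlgebra.tprod k V n u) (TensorAlgebra.tprod k V n v) := by
    intro u v
    change ExtForm.Phi E P b deg n (s (clProd E 𝒱 0 u)) (s (clProd E 𝒱 0 v)) = _
    rw [ExtForm.clProd_eq, ExtForm.clProd_eq, hPhi]
  have hform : ∀ (u v : Fin n → V) (du : Fin n → Γ), (∀ i, u i ∈ 𝒱 (du i)) →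
      β (extGen E 𝒱 u) (extGen E 𝒱 v) = ExtForm.S E P u v du := by
    intro u v du hu
    rw [hβ, ExtForm.Phi_hom E 𝒱 P b deg hrepr u v du hu]
  refine ⟨β, ?_, ?_, ?_⟩
  · intro u v du dv hu _
    exact hform u v du hu
  · intro u v du dv hu hv
    rw [hform u v du hu, hform v u dv hv]
    exact ExtForm.S_symm E 𝒱 P hPsymm hPdeg u v du dv hu hv
  · intro x hx
    have hmem : (x : Cliff E 𝒱 (0 : V →ₗ[k] V →ₗ[k] k)) ∈ Submodule.span k
        (Set.range fun w : Fin n → _ => clProd E 𝒱 0 (fun i => b (w i))) := by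
      refine (Submodule.span_le.mpr ?_) x.2
      rintro _ ⟨v, rfl⟩
      exact ExtForm.clProd_mem E 𝒱 b v
    obtain ⟨c, hc⟩ := (Submodule.mem_span_range_iff_exists_fun k).mp hmem
    have hxc : x = ∑ w, c w • extGen E 𝒱 (fun i => b (w i)) := by
      apply Subtype.ext
      rw [← hc]
      simp [extGen]
    apply Subtype.ext
    rw [← hc]
    refine ExtForm.nondeg E 𝒱 P b deg hn hb b' hb' c fun v => ?_
    rw [← hx (extGen E 𝒱 v), hxc]
    simp only [map_sum, map_smul, LinearMap.sum_apply, LinearMap.smul_apply, smul_eq_mul]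
    refine Finset.sum_congr rfl fun w _ => ?_
    rw [hform _ v (fun i => deg (w i)) (fun i => hb _)]
end

section
/- The quantisation map Q_n: Λ^n_ε(V) → C_ε(V,(·,·)) is injective for every n (assuming char(k)=0 or n < char(k)); moreover when char(k)=0 the total map Σ_n Q_n : Λ_ε(V) → C_ε(V,(·,·)) is an isomorphism of Γ-graded vector spaces. -/
open scoped BigOperators TensorProduct

section QuantHelpers

set_option linter.unusedSectionVars false

variable {k Γ V : Type} [Field k] [AddCommGroup Γ] [DecidableEq Γ] [AddCommGroup V] [Module k V]

theorem qh_extend {M : Type} [AddCommGroup M] [Module k M] (𝒱 : Γ → Submodule k V)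
    (hint : DirectSum.IsInternal 𝒱) (f : ∀ a, 𝒱 a →ₗ[k] M) :
    ∃ F : V →ₗ[k] M, ∀ a w (hw : w ∈ 𝒱 a), F w = f a ⟨w, hw⟩ := by
  let e := LinearEquiv.ofBijective (DirectSum.coeLinearMap 𝒱) hint
  refine ⟨(DirectSum.toModule k Γ M f).comp e.symm.toLinearMap, fun a w hw => ?_⟩
  have : e.symm w = DirectSum.lof k Γ (fun a => 𝒱 a) a ⟨w, hw⟩ := by
    rw [LinearEquiv.symm_apply_eq]
    exact (DirectSum.coeLinearMap_lof 𝒱 a ⟨w, hw⟩).symm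
  rw [LinearMap.comp_apply]
  erw [this]
  rw [DirectSum.toModule_lof]

theorem qh_neg {A : Type} [Ring A] [Algebra k A] (r s t : k) (y z : A) :
    -(r • y) * -(s • z) + t • (-(s • z) * -(r • y)) = (r * s) • (y * z + t • (z * y)) := by
  rw [neg_mul_neg, neg_mul_neg]
  simp only [mul_smul_comm, smul_mul_assoc]
  module

theorem qh_homog (𝒱 : Γ → Submodule k V) (hint : DirectSum.IsInternal 𝒱)
    (p : Submodule k V) (h : ∀ a w, w ∈ 𝒱 a → w ∈ p) (v : V) : v ∈ p := by
  have h1 : (⨆ a, 𝒱 a) ≤ p := iSup_le fun a w hw => h a w hw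
  rw [hint.submodule_iSup_eq_top] at h1
  exact h1 trivial

variable (E : CommFactor k Γ) (𝒱 : Γ → Submodule k V) (P : V →ₗ[k] V →ₗ[k] k)

/-- linear version of `cl` -/
noncomputable def qhcl : V →ₗ[k] Cliff E 𝒱 P :=
  (RingQuot.mkAlgHom k (CliffRel E 𝒱 P)).toLinearMap.comp (TensorAlgebra.ι k)

theorem qhcl_apply (v : V) : qhcl E 𝒱 P v = cl E 𝒱 P v := rfl

theorem qh_rel (a b : Γ) (x y : V) (hx : x ∈ 𝒱 a) (hy : y ∈ 𝒱 b) :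
    qhcl E 𝒱 P x * qhcl E 𝒱 P y + E.eps a b • (qhcl E 𝒱 P y * qhcl E 𝒱 P x)
      = (2 * P x y) • (1 : Cliff E 𝒱 P) := by
  have := RingQuot.mkAlgHom_rel k (CliffRel.mk (E := E) (𝒱 := 𝒱) (P := P) a b x y hx hy)
  simp only [map_add, map_mul, map_smul, map_one] at this
  exact this

theorem qh_ind (p : Submodule k (Cliff E 𝒱 P)) (h1 : 1 ∈ p)
    (hm : ∀ w u, u ∈ p → qhcl E 𝒱 P w * u ∈ p) (z : Cliff E 𝒱 P) : z ∈ p := by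
  obtain ⟨t, rfl⟩ := RingQuot.mkAlgHom_surjective k (CliffRel E 𝒱 P) z
  have key : ∀ u ∈ p, RingQuot.mkAlgHom k (CliffRel E 𝒱 P) t * u ∈ p := by
    induction t using TensorAlgebra.induction with
    | algebraMap r =>
      intro u hu
      rw [AlgHom.commutes, ← Algebra.smul_def]
      exact p.smul_mem _ hu
    | ι x => exact fun u hu => hm x u hu
    | mul a b ha hb =>
      intro u hu
      rw [map_mul, mul_assoc]
      exact ha _ (hb _ hu)
    | add a b ha hb =>
      intro u hu
      rw [map_add, add_mul]
      exact p.add_mem (ha _ hu) (hb _ hu)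
  simpa using key 1 h1

theorem qh_lift {A : Type} [Semiring A] [Algebra k A] (f : V →ₗ[k] A)
    (hf : ∀ a b x y, x ∈ 𝒱 a → y ∈ 𝒱 b →
      f x * f y + E.eps a b • (f y * f x) = (2 * P x y) • (1 : A)) :
    ∃ F : Cliff E 𝒱 P →ₐ[k] A, ∀ v, F (qhcl E 𝒱 P v) = f v := by
  refine ⟨RingQuot.liftAlgHom k ⟨TensorAlgebra.lift k f, ?_⟩, fun v => ?_⟩
  · rintro _ _ ⟨a, b, x, y, hx, hy⟩
    simpa only [map_add, map_mul, map_smul, map_one, TensorAlgebra.lift_ι_apply] using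
      hf a b x y hx hy
  · simp only [qhcl, LinearMap.comp_apply, AlgHom.toLinearMap_apply]
    rw [RingQuot.liftAlgHom_mkAlgHom_apply]
    simp

/-- products of fewer than `m` vectors -/
noncomputable def qhF (m : ℕ) : Submodule k (Cliff E 𝒱 P) :=
  Submodule.span k {z | ∃ l : List V, l.length < m ∧ z = (l.map (qhcl E 𝒱 P)).prod}

theorem qhF_mono {m n : ℕ} (h : m ≤ n) : qhF E 𝒱 P m ≤ qhF E 𝒱 P n := by
  refine Submodule.span_mono ?_
  rintro z ⟨l, hl, rfl⟩
  exact ⟨l, by omega, rfl⟩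

theorem qhF_mul {m : ℕ} (w : V) {u : Cliff E 𝒱 P} (hu : u ∈ qhF E 𝒱 P m) :
    qhcl E 𝒱 P w * u ∈ qhF E 𝒱 P (m + 1) := by
  induction hu using Submodule.span_induction with
  | mem x hx =>
    obtain ⟨l, hl, rfl⟩ := hx
    exact Submodule.subset_span ⟨w :: l, by simpa using hl, by simp⟩
  | zero => simp
  | add x y _ _ hx hy => rw [mul_add]; exact Submodule.add_mem _ hx hy
  | smul c x _ hx => rw [mul_smul_comm]; exact Submodule.smul_mem _ _ hx

theorem qhF_list {m : ℕ} (l : List V) (h : l.length < m) :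
    (l.map (qhcl E 𝒱 P)).prod ∈ qhF E 𝒱 P m :=
  Submodule.subset_span ⟨l, h, rfl⟩

theorem qhF_zero : qhF E 𝒱 P 0 = ⊥ := by
  rw [qhF, Submodule.span_eq_bot]
  rintro z ⟨l, hl, -⟩
  omega

theorem qhF_exists (z : Cliff E 𝒱 P) : ∃ m, z ∈ qhF E 𝒱 P m := by
  let p : Submodule k (Cliff E 𝒱 P) :=
    { carrier := {z | ∃ m, z ∈ qhF E 𝒱 P m}
      zero_mem' := ⟨0, Submodule.zero_mem _⟩
      add_mem' := by
        rintro a b ⟨m, hm⟩ ⟨n, hn⟩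
        exact ⟨max m n, Submodule.add_mem _ (qhF_mono E 𝒱 P (le_max_left _ _) hm)
          (qhF_mono E 𝒱 P (le_max_right _ _) hn)⟩
      smul_mem' := by
        rintro c a ⟨m, hm⟩
        exact ⟨m, Submodule.smul_mem _ _ hm⟩ }
  refine qh_ind E 𝒱 P p ⟨1, ?_⟩ ?_ z
  · exact qhF_list E 𝒱 P [] (by simp)
  · rintro w u ⟨m, hm⟩
    exact ⟨m + 1, qhF_mul E 𝒱 P w hm⟩

theorem qh_clProd {n : ℕ} (v : Fin n → V) :
    clProd E 𝒱 P v = ((List.ofFn v).map (qhcl E 𝒱 P)).prod := by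
  rw [clProd, List.map_ofFn]; rfl

theorem qh_clProd_succ {n : ℕ} (v : Fin (n + 1) → V) :
    clProd E 𝒱 P v = qhcl E 𝒱 P (v 0) * clProd E 𝒱 P (fun i => v i.succ) := by
  simp [qh_clProd]

theorem qh_clProd_mem {n : ℕ} (v : Fin n → V) : clProd E 𝒱 P v ∈ qhF E 𝒱 P (n + 1) := by
  rw [qh_clProd]; exact qhF_list E 𝒱 P _ (by simp)

/-- swapping two neighbours modulo lower order -/
theorem qh_swap {n : ℕ} (p : Fin n) (u : Fin (n + 1) → V) (a b : Γ)
    (ha : u p.castSucc ∈ 𝒱 a) (hb : u p.succ ∈ 𝒱 b) :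
    clProd E 𝒱 P u + E.eps a b • clProd E 𝒱 P (u ∘ Equiv.swap p.castSucc p.succ)
      ∈ qhF E 𝒱 P (n + 1) := by
  induction n with
  | zero => exact p.elim0
  | succ n ih =>
    induction p using Fin.cases with
    | zero =>
      have e : (fun i : Fin n => (u ∘ Equiv.swap (Fin.castSucc (0 : Fin (n+1))) (Fin.succ 0)) i.succ.succ)
          = fun i => u i.succ.succ := by
        funext i
        simp only [Function.comp]
        rw [Equiv.swap_apply_of_ne_of_ne] <;> simp [Fin.ext_iff]
      rw [qh_clProd_succ, qh_clProd_succ, qh_clProd_succ E 𝒱 P (u ∘ _), qh_clProd_succ E 𝒱 P (fun i => (u ∘ _) (Fin.succ i)), e]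
      have h := qh_rel E 𝒱 P a b _ _ ha hb
      have e0 : (u ∘ Equiv.swap (Fin.castSucc (0 : Fin (n+1))) (Fin.succ 0)) 0 = u (Fin.succ 0) := by
        simp
      have e1 : (u ∘ Equiv.swap (Fin.castSucc (0 : Fin (n+1))) (Fin.succ 0)) (Fin.succ 0) = u 0 := by
        simp
      rw [e0, e1, ← mul_assoc, ← mul_assoc, ← smul_mul_assoc, ← add_mul]
      rw [Fin.castSucc_zero] at h
      rw [h, smul_mul_assoc, one_mul]
      exact Submodule.smul_mem _ _ (qhF_mono E 𝒱 P (by omega) (qh_clProd_mem E 𝒱 P _))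
    | succ q =>
      have e : (fun i : Fin (n+1) => (u ∘ Equiv.swap q.succ.castSucc q.succ.succ) i.succ)
          = (fun i : Fin (n+1) => u i.succ) ∘ Equiv.swap q.castSucc q.succ := by
        funext i
        simp only [Function.comp, Equiv.swap_apply_def, Fin.ext_iff, Fin.val_succ, Fin.val_castSucc]
        congr 1
        simp only [Nat.add_right_cancel_iff]
        split_ifs <;> simp [Fin.ext_iff]
      have e0 : (u ∘ Equiv.swap q.succ.castSucc q.succ.succ) 0 = u 0 := by
        simp only [Function.comp]
        rw [Equiv.swap_apply_of_ne_of_ne] <;> simp [Fin.ext_iff]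
      rw [qh_clProd_succ, qh_clProd_succ E 𝒱 P (u ∘ _), e, e0, ← mul_smul_comm, ← mul_add]
      refine qhF_mul E 𝒱 P _ (ih q (fun i => u i.succ) ?_ hb)
      simpa using ha

theorem qh_cocycle_one {n : ℕ} (d : Fin n → Γ) : cocycle E 1 d = 1 := by
  rw [cocycle, Finset.filter_false_of_mem]
  · simp
  · rintro ⟨i, j⟩ - ⟨h1, h2⟩
    simp at h1 h2
    exact absurd h1 (not_lt.2 h2.le)

theorem qh_cocycle_asc {n : ℕ} (σ : Equiv.Perm (Fin (n + 1))) (p : Fin n) (d : Fin (n + 1) → Γ)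
    (h : σ p.castSucc < σ p.succ) :
    cocycle E (σ * Equiv.swap p.castSucc p.succ) d
      = - E.eps (d (σ p.castSucc)) (d (σ p.succ)) * cocycle E σ d := by
  have hne : p.castSucc ≠ p.succ := by simp [Fin.ext_iff]
  have hf : (Finset.univ.filter (fun x : Fin (n+1) × Fin (n+1) => x.1 < x.2 ∧
      (σ * Equiv.swap p.castSucc p.succ)⁻¹ x.2 < (σ * Equiv.swap p.castSucc p.succ)⁻¹ x.1))
      = insert (σ p.castSucc, σ p.succ) (Finset.univ.filter
        (fun x : Fin (n+1) × Fin (n+1) => x.1 < x.2 ∧ σ⁻¹ x.2 < σ⁻¹ x.1)) := by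
    ext ⟨i, j⟩
    have hinv : ∀ t, σ⁻¹ (σ t) = t := fun t => σ.symm_apply_apply t
    obtain ⟨i, rfl⟩ := σ.surjective i
    obtain ⟨j, rfl⟩ := σ.surjective j
    simp only [Finset.mem_filter, Finset.mem_univ, true_and, Finset.mem_insert, Prod.mk.injEq,
      mul_inv_rev, Equiv.Perm.mul_apply, hinv, Equiv.swap_inv,
      σ.injective.eq_iff]
    have key : ∀ a b : Fin (n+1), Equiv.swap p.castSucc p.succ a < Equiv.swap p.castSucc p.succ b ↔
        (a < b ∧ ¬ (a = p.castSucc ∧ b = p.succ)) ∨ (a = p.succ ∧ b = p.castSucc) := by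
      intro a b
      simp only [Equiv.swap_apply_def]
      split_ifs <;> simp only [Fin.ext_iff, Fin.lt_def, Fin.val_succ, Fin.val_castSucc] at * <;> omega
    rw [key]
    constructor
    · rintro ⟨h1, h2 | ⟨rfl, rfl⟩⟩
      · exact Or.inr ⟨h1, h2.1⟩
      · exact Or.inl ⟨rfl, rfl⟩
    · rintro (⟨rfl, rfl⟩ | ⟨h1, h2⟩)
      · exact ⟨h, Or.inr ⟨rfl, rfl⟩⟩
      · refine ⟨h1, Or.inl ⟨h2, ?_⟩⟩
        rintro ⟨rfl, rfl⟩
        exact absurd h (not_lt.2 h1.le)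
  rw [cocycle, hf, Finset.prod_insert, cocycle, Equiv.Perm.sign_mul, Equiv.Perm.sign_swap hne]
  · push_cast
    ring
  · have hinv : ∀ t, σ⁻¹ (σ t) = t := fun t => σ.symm_apply_apply t
    simp only [Finset.mem_filter, hinv, not_and, not_lt]
    intro _ _
    exact (Fin.castSucc_lt_succ (i := p)).le

theorem qh_cocycle_mul {n : ℕ} (σ : Equiv.Perm (Fin (n + 1))) (p : Fin n) (d : Fin (n + 1) → Γ) :
    cocycle E (σ * Equiv.swap p.castSucc p.succ) d
      = - E.eps (d (σ p.castSucc)) (d (σ p.succ)) * cocycle E σ d := by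
  have hne : p.castSucc ≠ p.succ := by simp [Fin.ext_iff]
  rcases lt_or_gt_of_ne (σ.injective.ne hne) with h | h
  · exact qh_cocycle_asc E σ p d h
  · have := qh_cocycle_asc E (σ * Equiv.swap p.castSucc p.succ) p d (by simpa using h)
    rw [mul_assoc, Equiv.swap_mul_self, mul_one] at this
    rw [this]
    simp only [Equiv.Perm.mul_apply, Equiv.swap_apply_left, Equiv.swap_apply_right]
    have h2 := E.eps_symm (d (σ p.castSucc)) (d (σ p.succ))
    linear_combination (- cocycle E (σ * Equiv.swap p.castSucc p.succ) d) * h2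

theorem qh_perm {n : ℕ} (v : Fin n → V) (d : Fin n → Γ) (hv : ∀ i, v i ∈ 𝒱 (d i))
    (σ : Equiv.Perm (Fin n)) :
    cocycle E σ d • clProd E 𝒱 P (v ∘ σ) - clProd E 𝒱 P v ∈ qhF E 𝒱 P n := by
  cases n with
  | zero =>
    rw [Subsingleton.elim σ 1, qh_cocycle_one]
    simp
  | succ n =>
    have hσ : σ ∈ Submonoid.closure (Set.range fun i : Fin n => Equiv.swap i.castSucc i.succ) := by
      rw [Equiv.Perm.mclosure_swap_castSucc_succ]; trivial
    induction hσ using Submonoid.closure_induction_right with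
    | one => rw [qh_cocycle_one]; simp
    | mul_right σ hσ s hs ih =>
      obtain ⟨p, rfl⟩ := hs
      have h := qh_swap E 𝒱 P p (v ∘ σ) _ _ (hv _) (hv _)
      have h2 := Submodule.sub_mem _ ih (Submodule.smul_mem _ (cocycle E σ d) h)
      rw [qh_cocycle_mul, Equiv.Perm.coe_mul, ← Function.comp_assoc]
      convert h2 using 1
      module

theorem qh_avg {n : ℕ} (hn : (n.factorial : k) ≠ 0)
    (v : Fin n → V) (d : Fin n → Γ) (hv : ∀ i, v i ∈ 𝒱 (d i)) :
    (n.factorial : k)⁻¹ • ∑ σ : Equiv.Perm (Fin n), cocycle E σ d • clProd E 𝒱 P (v ∘ σ)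
      - clProd E 𝒱 P v ∈ qhF E 𝒱 P n := by
  have h : ∑ σ : Equiv.Perm (Fin n), (cocycle E σ d • clProd E 𝒱 P (v ∘ σ) - clProd E 𝒱 P v)
      ∈ qhF E 𝒱 P n := Submodule.sum_mem _ fun σ _ => qh_perm E 𝒱 P v d hv σ
  have h2 := Submodule.smul_mem _ (n.factorial : k)⁻¹ h
  rw [Finset.sum_sub_distrib, Finset.sum_const, Finset.card_univ, Fintype.card_perm,
    Fintype.card_fin, smul_sub, ← Nat.cast_smul_eq_nsmul k, smul_smul, inv_mul_cancel₀ hn,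
    one_smul] at h2
  exact h2

/-- homogeneous products of exactly `n` vectors span. -/
theorem qh_span_homog (hint : DirectSum.IsInternal 𝒱) {n : ℕ} (v : Fin n → V) :
    clProd E 𝒱 P v ∈ Submodule.span k {z | ∃ (w : Fin n → V) (d : Fin n → Γ),
      (∀ i, w i ∈ 𝒱 (d i)) ∧ z = clProd E 𝒱 P w} := by
  induction n with
  | zero => exact Submodule.subset_span ⟨v, fun _ => 0, fun i => i.elim0, rfl⟩
  | succ n ih =>
    rw [qh_clProd_succ]
    have h := ih (fun i => v i.succ)
    generalize clProd E 𝒱 P (fun i => v i.succ) = t at h ⊢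
    induction h using Submodule.span_induction with
    | mem x hx =>
      obtain ⟨w, d, hw, rfl⟩ := hx
      refine qh_homog 𝒱 hint (Submodule.comap
        ((LinearMap.mulRight k (clProd E 𝒱 P w)).comp (qhcl E 𝒱 P)) (Submodule.span k _)) ?_ (v 0)
      intro a y hy
      refine Submodule.subset_span ⟨Fin.cons y w, Fin.cons a d, ?_, ?_⟩
      · intro i
        induction i using Fin.cases with
        | zero => simpa using hy
        | succ i => simpa using hw i
      · rw [qh_clProd_succ]; simp
    | zero => simp
    | add x y _ _ hx hy => rw [mul_add]; exact Submodule.add_mem _ hx hy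
    | smul c x _ hx => rw [mul_smul_comm]; exact Submodule.smul_mem _ _ hx

/-- degree projection on the exterior algebra -/
theorem qh_proj (n : ℕ) : ∃ π : Cliff E 𝒱 (0 : V →ₗ[k] V →ₗ[k] k) →ₗ[k] Cliff E 𝒱 (0 : V →ₗ[k] V →ₗ[k] k),
    (∀ z ∈ qhF E 𝒱 0 n, π z = 0) ∧ ∀ v : Fin n → V, π (clProd E 𝒱 0 v) = clProd E 𝒱 0 v := by
  let f : V →ₗ[k] Polynomial (Cliff E 𝒱 (0 : V →ₗ[k] V →ₗ[k] k)) :=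
    { toFun := fun v => Polynomial.monomial 1 (qhcl E 𝒱 0 v)
      map_add' := by intro x y; simp
      map_smul' := by
        intro c x
        rw [map_smul, RingHom.id_apply, Polynomial.smul_monomial] }
  obtain ⟨g, hg⟩ := qh_lift E 𝒱 0 f (by
    intro a b x y hx hy
    have h := qh_rel E 𝒱 0 a b x y hx hy
    simp only [f, LinearMap.coe_mk, AddHom.coe_mk, Polynomial.monomial_mul_monomial,
      Polynomial.smul_monomial]
    rw [← map_add, h]
    simp)
  have hl : ∀ l : List V, g ((l.map (qhcl E 𝒱 0)).prod)
      = Polynomial.monomial l.length ((l.map (qhcl E 𝒱 0)).prod) := by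
    intro l
    induction l with
    | nil => simp
    | cons w l ih =>
      rw [List.map_cons, List.prod_cons, map_mul, ih, hg]
      simp only [f, LinearMap.coe_mk, AddHom.coe_mk, Polynomial.monomial_mul_monomial]
      rw [List.length_cons, add_comm]
  let π : (Cliff E 𝒱 (0 : V →ₗ[k] V →ₗ[k] k)) →ₗ[k] (Cliff E 𝒱 (0 : V →ₗ[k] V →ₗ[k] k)) :=
    { toFun := fun z => (g z).coeff n
      map_add' := by intro x y; simp
      map_smul' := by intro c x; simp }
  refine ⟨π, fun z hz => ?_, fun v => ?_⟩
  · have : qhF E 𝒱 0 n ≤ LinearMap.ker π := by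
      refine Submodule.span_le.2 ?_
      rintro _ ⟨l, hl', rfl⟩
      change (g _).coeff n = 0
      rw [hl, Polynomial.coeff_monomial, if_neg (by omega)]
    exact this hz
  · change (g _).coeff n = _
    rw [qh_clProd, hl, Polynomial.coeff_monomial, if_pos (by simp)]

theorem qh_contr (hint : DirectSum.IsInternal 𝒱)
    (hPdeg : ∀ a b : Γ, a + b ≠ 0 → ∀ v ∈ 𝒱 a, ∀ w ∈ 𝒱 b, P v w = 0) :
    ∃ τ : Γ → V →ₗ[k] V, (∀ a b w, w ∈ 𝒱 b → τ a w = (- E.eps a b) • w) ∧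
    ∃ ι : V →ₗ[k] Module.End k (Cliff E 𝒱 (0 : V →ₗ[k] V →ₗ[k] k)),
      ∀ a x, x ∈ 𝒱 a → ι x 1 = 0 ∧ ∀ w u,
        ι x (qhcl E 𝒱 0 w * u) = P x w • u + qhcl E 𝒱 0 (τ a w) * ι x u := by
  have hτ : ∀ a, ∃ τ : V →ₗ[k] V, ∀ b w, w ∈ 𝒱 b → τ w = (- E.eps a b) • w := by
    intro a
    obtain ⟨F, hF⟩ := qh_extend 𝒱 hint (fun b => (- E.eps a b) • (𝒱 b).subtype)
    exact ⟨F, fun b w hw => by simp [hF b w hw]⟩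
  choose τ hτ using hτ
  refine ⟨τ, hτ, ?_⟩
  have e0 : ∀ c, E.eps 0 c = 1 := by
    intro c
    have h1 := E.eps_add_left 0 0 c
    have h2 := E.eps_symm 0 c
    rw [add_zero] at h1
    have : E.eps 0 c ≠ 0 := left_ne_zero_of_mul_eq_one h2
    exact mul_left_cancel₀ this (by rw [mul_one]; exact h1.symm)
  have one : ∀ a x, x ∈ 𝒱 a → ∃ j : (Cliff E 𝒱 (0 : V →ₗ[k] V →ₗ[k] k)) →ₗ[k] (Cliff E 𝒱 (0 : V →ₗ[k] V →ₗ[k] k)), j 1 = 0 ∧ ∀ w u,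
        j (qhcl E 𝒱 0 w * u) = P x w • u + qhcl E 𝒱 0 (τ a w) * j u := by
    intro a x hx
    let f : V →ₗ[k] Matrix (Fin 2) (Fin 2) (Cliff E 𝒱 (0 : V →ₗ[k] V →ₗ[k] k)) :=
      { toFun := fun w => !![qhcl E 𝒱 0 (τ a w), P x w • 1; 0, qhcl E 𝒱 0 w]
        map_add' := by
          intro y z
          ext i j; fin_cases i <;> fin_cases j <;> simp [add_smul]
        map_smul' := by
          intro c z
          ext i j; fin_cases i <;> fin_cases j <;> simp [mul_smul] }
    have hf : ∀ w, f w = !![qhcl E 𝒱 0 (τ a w), P x w • 1; 0, qhcl E 𝒱 0 w] := fun _ => rfl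
    obtain ⟨g, hg⟩ := qh_lift E 𝒱 0 f (by
      intro b c y z hy hz
      have h := qh_rel E 𝒱 0 b c y z hy hz
      simp only [LinearMap.zero_apply, mul_zero, zero_smul] at h ⊢
      rw [hf, hf, hτ a b y hy, hτ a c z hz]
      have k1 : P x y * (1 - E.eps b c * E.eps a c) = 0 := by
        by_cases hab : a + b = 0
        · have h3 := E.eps_add_left a b c
          rw [hab, e0] at h3
          rw [h3]; ring
        · rw [hPdeg a b hab x hx y hy, zero_mul]
      have k2 : P x z * (E.eps b c - E.eps a b) = 0 := by
        by_cases hac : a + c = 0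
        · have h3 := E.eps_add_left a c b
          rw [hac, e0] at h3
          have h4 := E.eps_symm b c
          have : E.eps b c = E.eps a b := by linear_combination E.eps b c * h3 + E.eps a b * h4
          rw [this]; ring
        · rw [hPdeg a c hac x hx z hz, zero_mul]
      ext i j; fin_cases i <;> fin_cases j
      · simp
        have h5 := congrArg (fun t => (E.eps a b * E.eps a c) • t) h
        simp only [smul_zero] at h5
        rw [← h5]
        exact qh_neg (A := Cliff E 𝒱 (0 : V →ₗ[k] V →ₗ[k] k)) (E.eps a b) (E.eps a c) (E.eps b c)
          (qhcl E 𝒱 0 y) (qhcl E 𝒱 0 z)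
      · simp
        have h6 : (P x y * (1 - E.eps b c * E.eps a c)) • qhcl E 𝒱 0 z
            + (P x z * (E.eps b c - E.eps a b)) • qhcl E 𝒱 0 y = 0 := by
          rw [k1, k2]; simp
        rw [← h6]; module
      · simp
      · simpa using h)
    have low : ∀ u, g u 1 1 = u := by
      intro u
      have : u ∈ (LinearMap.eqLocus ((Matrix.entryLinearMap k (Cliff E 𝒱 (0 : V →ₗ[k] V →ₗ[k] k)) (1 : Fin 2) (1 : Fin 2)).comp g.toLinearMap) LinearMap.id) := by
        refine qh_ind E 𝒱 0 _ (by simp [LinearMap.mem_eqLocus]) ?_ u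
        intro w u hu
        simp only [LinearMap.mem_eqLocus, LinearMap.comp_apply, AlgHom.toLinearMap_apply,
          Matrix.entryLinearMap_apply, LinearMap.id_apply] at hu ⊢
        rw [map_mul, hg, hf, Matrix.mul_apply, Fin.sum_univ_two, hu]
        simp
      simpa [LinearMap.mem_eqLocus] using this
    refine ⟨(Matrix.entryLinearMap k (Cliff E 𝒱 (0 : V →ₗ[k] V →ₗ[k] k)) (0 : Fin 2) (1 : Fin 2)).comp g.toLinearMap, by simp, ?_⟩
    intro w u
    simp only [LinearMap.comp_apply, AlgHom.toLinearMap_apply, Matrix.entryLinearMap_apply]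
    rw [map_mul, hg, hf, Matrix.mul_apply, Fin.sum_univ_two, low]
    simp [add_comm]
  choose! j hj1 hj2 using one
  have huniq : ∀ (_ : Γ) (j1 j2 : (Cliff E 𝒱 (0 : V →ₗ[k] V →ₗ[k] k)) →ₗ[k] (Cliff E 𝒱 (0 : V →ₗ[k] V →ₗ[k] k))), j1 1 = j2 1 →
      (∀ w u, j1 u = j2 u → j1 (qhcl E 𝒱 0 w * u) = j2 (qhcl E 𝒱 0 w * u)) → j1 = j2 := by
    intro a j1 j2 h1 h2
    ext u
    exact qh_ind E 𝒱 0 (LinearMap.eqLocus j1 j2) h1 (fun w u hu => h2 w u hu) u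
  obtain ⟨ι, hι⟩ := qh_extend 𝒱 hint (M := Module.End k (Cliff E 𝒱 (0 : V →ₗ[k] V →ₗ[k] k))) (fun a =>
    { toFun := fun x => j a x.1
      map_add' := by
        rintro ⟨x, hx⟩ ⟨y, hy⟩
        refine huniq a _ _ ?_ ?_
        · simp [hj1 a _ hx, hj1 a _ hy, hj1 a _ (Submodule.add_mem _ hx hy)]
        · intro w u hu
          simp only [LinearMap.add_apply] at hu ⊢
          rw [hj2 a _ hx, hj2 a _ hy]
          simp only [Submodule.coe_add] at hu
          change j a (x + y) _ = _
          rw [hj2 a _ (Submodule.add_mem _ hx hy), hu, map_add, LinearMap.add_apply, mul_add]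
          module
      map_smul' := by
        rintro c ⟨x, hx⟩
        refine huniq a _ _ ?_ ?_
        · simp [hj1 a _ hx, hj1 a _ (Submodule.smul_mem _ c hx)]
        · intro w u hu
          simp only [LinearMap.smul_apply, RingHom.id_apply] at hu ⊢
          rw [hj2 a _ hx]
          change j a (c • x) _ = _
          change j a (c • x) _ = _ at hu
          rw [hj2 a _ (Submodule.smul_mem _ c hx), hu, map_smul, LinearMap.smul_apply,
            mul_smul_comm]
          simp only [smul_eq_mul]
          module })
  refine ⟨ι, fun a x hx => ?_⟩
  rw [hι a x hx]
  exact ⟨hj1 a x hx, hj2 a x hx⟩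

/-- Chevalley symbol map -/
theorem qh_symbol (hint : DirectSum.IsInternal 𝒱)
    (hPsymm : ∀ a b : Γ, ∀ v ∈ 𝒱 a, ∀ w ∈ 𝒱 b, P v w = E.eps a b * P w v)
    (hPdeg : ∀ a b : Γ, a + b ≠ 0 → ∀ v ∈ 𝒱 a, ∀ w ∈ 𝒱 b, P v w = 0) :
    ∃ S : Cliff E 𝒱 P →ₗ[k] Cliff E 𝒱 (0 : V →ₗ[k] V →ₗ[k] k),
      ∀ l : List V, S ((l.map (qhcl E 𝒱 P)).prod) - (l.map (qhcl E 𝒱 0)).prod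
        ∈ qhF E 𝒱 0 l.length := by
  obtain ⟨τ, hτ, ι, hι⟩ := qh_contr E 𝒱 P hint hPdeg
  have e0 : ∀ c, E.eps 0 c = 1 := by
    intro c
    have h1 := E.eps_add_left 0 0 c
    have h2 := E.eps_symm 0 c
    rw [add_zero] at h1
    have : E.eps 0 c ≠ 0 := left_ne_zero_of_mul_eq_one h2
    exact mul_left_cancel₀ this (by rw [mul_one]; exact h1.symm)
  -- the formula for homogeneous vectors
  have hιh : ∀ a b x w, x ∈ 𝒱 a → w ∈ 𝒱 b → ∀ u, ι x (qhcl E 𝒱 0 w * u)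
      = P x w • u - E.eps a b • (qhcl E 𝒱 0 w * ι x u) := by
    intro a b x w hx hw u
    rw [(hι a x hx).2, hτ a b w hw, map_smul, smul_mul_assoc]
    module
  have hanti : ∀ a b x y, x ∈ 𝒱 a → y ∈ 𝒱 b → ∀ u, ι x (ι y u) + E.eps a b • ι y (ι x u) = 0 := by
    intro a b x y hx hy u
    refine qh_ind E 𝒱 0 (LinearMap.ker (ι x * ι y + E.eps a b • (ι y * ι x))) ?_ ?_ u
    · simp [(hι a x hx).1, (hι b y hy).1]
    · intro w u hu
      revert w
      intro w
      refine qh_homog 𝒱 hint (Submodule.comap ((LinearMap.mulRight k u).comp (qhcl E 𝒱 0))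
        (LinearMap.ker (ι x * ι y + E.eps a b • (ι y * ι x)))) ?_ w
      intro c w hw
      simp only [Submodule.mem_comap, LinearMap.mem_ker, LinearMap.add_apply,
        LinearMap.smul_apply, Module.End.mul_apply, LinearMap.comp_apply,
        LinearMap.mulRight_apply] at hu ⊢
      rw [hιh b c y w hy hw, hιh a c x w hx hw, map_sub, map_sub, map_smul, map_smul, map_smul,
        map_smul, hιh b c y w hy hw, hιh a c x w hx hw]
      have k1 : P y w * (1 - E.eps a b * E.eps a c) = 0 := by
        by_cases hbc : b + c = 0
        · have h3 := E.eps_add_right a b c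
          have h5 := E.eps_symm a 0
          rw [e0, mul_one] at h5
          rw [hbc, h5] at h3
          rw [← h3]; ring
        · rw [hPdeg b c hbc y hy w hw, zero_mul]
      have k2 : P x w * (E.eps a b - E.eps b c) = 0 := by
        by_cases hac : a + c = 0
        · have h3 := E.eps_add_left a c b
          rw [hac, e0] at h3
          have h4 := E.eps_symm b c
          have : E.eps b c = E.eps a b := by linear_combination E.eps b c * h3 + E.eps a b * h4
          rw [this]; ring
        · rw [hPdeg a c hac x hx w hw, zero_mul]
      have h6 : (P y w * (1 - E.eps a b * E.eps a c)) • ι x u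
            + (P x w * (E.eps a b - E.eps b c)) • ι y u
            + (E.eps a c * E.eps b c) • (qhcl E 𝒱 0 w * (ι x (ι y u) + E.eps a b • ι y (ι x u)))
            = 0 := by
          rw [k1, k2, hu]; simp
      rw [mul_add, mul_smul_comm] at h6
      rw [← h6]; module
  let c : V →ₗ[k] Module.End k (Cliff E 𝒱 (0 : V →ₗ[k] V →ₗ[k] k)) := (LinearMap.mul k (Cliff E 𝒱 (0 : V →ₗ[k] V →ₗ[k] k))).comp (qhcl E 𝒱 0) + ι
  have hc : ∀ v u, c v u = qhcl E 𝒱 0 v * u + ι v u := fun v u => rfl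
  obtain ⟨g, hg⟩ := qh_lift E 𝒱 P c (by
    intro a b x y hx hy
    ext u
    simp only [LinearMap.add_apply, LinearMap.smul_apply, Module.End.mul_apply, hc, map_add,
      Module.End.one_apply]
    have h1 := congrArg (· * u) (qh_rel E 𝒱 0 a b x y hx hy)
    simp only [LinearMap.zero_apply, mul_zero, zero_smul, zero_mul, add_mul, smul_mul_assoc,
      mul_assoc] at h1
    have h2 := hanti a b x y hx hy u
    rw [hιh a b x y hx hy, hιh b a y x hy hx]
    have h3 := hPsymm a b x hx y hy
    have h4 := E.eps_symm a b
    have h5 : (2 * P x y) • u = (P x y + E.eps a b * P y x) • u + ((1 - E.eps a b * E.eps b a)) • (qhcl E 𝒱 0 x * ι y u) + (0:(Cliff E 𝒱 (0 : V →ₗ[k] V →ₗ[k] k))) + 0 := by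
      rw [← h3, h4, sub_self, zero_smul, add_zero, add_zero, add_zero, two_mul]
    rw [h5]
    nth_rewrite 1 [← h1]
    rw [← h2]
    simp only [mul_add]
    module)
  -- contraction preserves the filtration
  have hιF : ∀ m u, u ∈ qhF E 𝒱 0 m → ∀ v, ι v u ∈ qhF E 𝒱 0 m := by
    intro m u hu v
    refine qh_homog 𝒱 hint (Submodule.comap (ι.flip u) (qhF E 𝒱 0 m)) ?_ v
    intro a x hx
    change ι x u ∈ qhF E 𝒱 0 m
    have hsub : qhF E 𝒱 0 m ≤ Submodule.comap (ι x) (qhF E 𝒱 0 m) := by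
      clear hu
      refine Submodule.span_le.2 ?_
      rintro _ ⟨l, hl, rfl⟩
      change ι x _ ∈ qhF E 𝒱 0 m
      induction l generalizing m with
      | nil => simp [(hι a x hx).1]
      | cons w l ih =>
        rw [List.map_cons, List.prod_cons, (hι a x hx).2]
        obtain ⟨m, rfl⟩ : ∃ m', m = m' + 1 := ⟨m - 1, by simp at hl; omega⟩
        simp only [List.length_cons, Nat.add_lt_add_iff_right] at hl
        refine Submodule.add_mem _ (Submodule.smul_mem _ _ (qhF_list E 𝒱 0 l (by omega))) ?_
        exact qhF_mul E 𝒱 0 _ (ih m hl)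
    exact hsub hu
  refine ⟨(LinearMap.applyₗ (1 : (Cliff E 𝒱 (0 : V →ₗ[k] V →ₗ[k] k)))).comp g.toLinearMap, fun l => ?_⟩
  change g _ 1 - _ ∈ qhF E 𝒱 0 l.length
  induction l with
  | nil => simp
  | cons w l ih =>
    rw [List.map_cons, List.prod_cons, map_mul, hg, Module.End.mul_apply, hc, List.map_cons,
      List.prod_cons, List.length_cons]
    have h1 := qhF_mul E 𝒱 0 w ih
    have h3 : g ((l.map (qhcl E 𝒱 P)).prod) 1 ∈ qhF E 𝒱 0 (l.length + 1) := by
      have := Submodule.add_mem _ (qhF_mono E 𝒱 0 (Nat.le_succ _) ih)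
        (qhF_list E 𝒱 0 l (Nat.lt_succ_self _))
      simpa using this
    have h2 := Submodule.add_mem _ h1 (hιF _ _ h3 w)
    rw [mul_sub] at h2
    convert h2 using 1
    abel

end QuantHelpers

/-- The quantisation map `Q_n : Λⁿ_ε(V) → C_ε(V)` is injective whenever `n!` is
invertible, and in characteristic `0` the total quantisation map
`Λ_ε(V) → C_ε(V)` is a linear isomorphism. -/
theorem quantisation_injective_bijective {k Γ V : Type} [Field k] [AddCommGroup Γ]
    [DecidableEq Γ] [AddCommGroup V] [Module k V] [FiniteDimensional k V]
    (E : CommFactor k Γ) (𝒱 : Γ → Submodule k V) (hint : DirectSum.IsInternal 𝒱)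
    (P : V →ₗ[k] V →ₗ[k] k)
    (hPsymm : ∀ a b : Γ, ∀ v ∈ 𝒱 a, ∀ w ∈ 𝒱 b, P v w = E.eps a b * P w v)
    (hPdeg : ∀ a b : Γ, a + b ≠ 0 → ∀ v ∈ 𝒱 a, ∀ w ∈ 𝒱 b, P v w = 0)
    (n : ℕ) (hn : (n.factorial : k) ≠ 0)
    (Q : ↥(extPow E 𝒱 n) →ₗ[k] Cliff E 𝒱 P)
    (hQ : ∀ (v : Fin n → V) (dv : Fin n → Γ), (∀ i, v i ∈ 𝒱 (dv i)) →
        Q (extGen E 𝒱 v)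
          = (n.factorial : k)⁻¹ • ∑ σ : Equiv.Perm (Fin n),
              cocycle E σ dv • clProd E 𝒱 P (v ∘ σ))
    (Qt : Cliff E 𝒱 (0 : V →ₗ[k] V →ₗ[k] k) →ₗ[k] Cliff E 𝒱 P)
    (hQt : ∀ (m : ℕ) (v : Fin m → V) (dv : Fin m → Γ), (∀ i, v i ∈ 𝒱 (dv i)) →
        Qt (clProd E 𝒱 0 v)
          = (m.factorial : k)⁻¹ • ∑ σ : Equiv.Perm (Fin m),
              cocycle E σ dv • clProd E 𝒱 P (v ∘ σ)) :
    Function.Injective Q ∧ (CharZero k → Function.Bijective Qt) := by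
  obtain ⟨S, hS⟩ := qh_symbol E 𝒱 P hint hPsymm hPdeg
  have hS' : ∀ {m : ℕ} (v : Fin m → V), S (clProd E 𝒱 P v) - clProd E 𝒱 0 v ∈ qhF E 𝒱 0 m := by
    intro m v
    have := hS (List.ofFn v)
    rwa [← qh_clProd, ← qh_clProd, List.length_ofFn] at this
  have hSF : ∀ m z, z ∈ qhF E 𝒱 P m → S z ∈ qhF E 𝒱 0 m := by
    intro m z hz
    have : qhF E 𝒱 P m ≤ Submodule.comap S (qhF E 𝒱 0 m) := by
      refine Submodule.span_le.2 ?_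
      rintro _ ⟨l, hl, rfl⟩
      have := Submodule.add_mem _ (qhF_mono E 𝒱 0 hl.le (hS l)) (qhF_list E 𝒱 0 l hl)
      simpa using this
    exact this hz
  have hSavg : ∀ (m : ℕ), (m.factorial : k) ≠ 0 → ∀ (v : Fin m → V) (d : Fin m → Γ),
      (∀ i, v i ∈ 𝒱 (d i)) → S ((m.factorial : k)⁻¹ • ∑ σ : Equiv.Perm (Fin m),
        cocycle E σ d • clProd E 𝒱 P (v ∘ σ)) - clProd E 𝒱 0 v ∈ qhF E 𝒱 0 m := by
    intro m hm v d hv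
    have h1 := hSF _ _ (qh_avg E 𝒱 P hm v d hv)
    have h2 := Submodule.add_mem _ h1 (hS' v)
    rw [map_sub, sub_add_sub_cancel] at h2
    exact h2
  constructor
  · obtain ⟨π, hπ0, hπ1⟩ := qh_proj E 𝒱 n
    have key : ∀ z ∈ Submodule.span k {z | ∃ (w : Fin n → V) (d : Fin n → Γ),
        (∀ i, w i ∈ 𝒱 (d i)) ∧ z = clProd E 𝒱 0 w}, ∃ hz : z ∈ extPow E 𝒱 n,
        π (S (Q ⟨z, hz⟩)) = z := by
      intro z hz
      induction hz using Submodule.span_induction with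
      | mem x hx =>
        obtain ⟨w, d, hw, rfl⟩ := hx
        refine ⟨(extGen E 𝒱 w).2, ?_⟩
        change π (S (Q (extGen E 𝒱 w))) = _
        rw [hQ w d hw]
        have := hπ0 _ (hSavg n hn w d hw)
        rwa [map_sub, hπ1, sub_eq_zero] at this
      | zero => exact ⟨Submodule.zero_mem _, by
          change π (S (Q 0)) = 0
          simp⟩
      | add x y _ _ hx hy =>
        obtain ⟨hx, ex⟩ := hx
        obtain ⟨hy, ey⟩ := hy
        refine ⟨Submodule.add_mem _ hx hy, ?_⟩
        change π (S (Q (⟨x, hx⟩ + ⟨y, hy⟩))) = _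
        rw [map_add, map_add, map_add, ex, ey]
      | smul c x _ hx =>
        obtain ⟨hx, ex⟩ := hx
        refine ⟨Submodule.smul_mem _ c hx, ?_⟩
        change π (S (Q (c • ⟨x, hx⟩))) = _
        rw [map_smul, map_smul, map_smul, ex]
    have hle : extPow E 𝒱 n ≤ Submodule.span k {z | ∃ (w : Fin n → V) (d : Fin n → Γ),
        (∀ i, w i ∈ 𝒱 (d i)) ∧ z = clProd E 𝒱 0 w} := by
      refine Submodule.span_le.2 ?_
      rintro _ ⟨v, rfl⟩
      exact qh_span_homog E 𝒱 0 hint v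
    rintro ⟨z, hz⟩ ⟨y, hy⟩ h0
    obtain ⟨hz', e⟩ := key z (hle hz)
    obtain ⟨hy', e'⟩ := key y (hle hy)
    rw [h0, e'] at e
    exact Subtype.ext e.symm
  · intro hchar
    have hfac : ∀ m : ℕ, (m.factorial : k) ≠ 0 := fun m => by
      exact_mod_cast m.factorial_ne_zero
    -- filtration steps are spanned by homogeneous products
    have hspan : ∀ (R : V →ₗ[k] V →ₗ[k] k) (m : ℕ) (p : Submodule k (Cliff E 𝒱 R)),
        (∀ j, j < m → ∀ (w : Fin j → V) (d : Fin j → Γ), (∀ i, w i ∈ 𝒱 (d i)) →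
          clProd E 𝒱 R w ∈ p) → qhF E 𝒱 R m ≤ p := by
      intro R m p h
      refine Submodule.span_le.2 ?_
      rintro _ ⟨l, hl, rfl⟩
      have h1 := qh_span_homog E 𝒱 R hint (fun i : Fin l.length => l.get i)
      rw [qh_clProd, List.ofFn_get] at h1
      refine (Submodule.span_le.2 ?_) h1
      rintro _ ⟨w, d, hw, rfl⟩
      exact h _ hl w d hw
    constructor
    · have step : ∀ m, qhF E 𝒱 0 (m + 1) ≤
          Submodule.comap (S.comp Qt - LinearMap.id) (qhF E 𝒱 0 m) := by
        intro m
        refine hspan 0 _ _ ?_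
        intro j hj w d hw
        rw [Submodule.mem_comap, LinearMap.sub_apply, LinearMap.comp_apply, hQt j w d hw,
          LinearMap.id_apply]
        exact qhF_mono E 𝒱 0 (by omega) (hSavg j (hfac j) w d hw)
      intro x y hxy
      have hz : Qt (x - y) = 0 := by rw [map_sub, hxy, sub_self]
      rw [← sub_eq_zero]
      generalize x - y = z at hz
      obtain ⟨m, hm⟩ := qhF_exists E 𝒱 0 z
      induction m with
      | zero => rwa [qhF_zero, Submodule.mem_bot] at hm
      | succ m ih =>
        have := step m hm
        rw [Submodule.mem_comap, LinearMap.sub_apply, LinearMap.comp_apply, hz, map_zero,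
          zero_sub, LinearMap.id_apply] at this
        exact ih (by simpa using this)
    · have hr : ∀ m, qhF E 𝒱 P m ≤ LinearMap.range Qt := by
        intro m
        induction m with
        | zero => rw [qhF_zero]; exact bot_le
        | succ m ih =>
          refine hspan P _ _ ?_
          intro j hj w d hw
          have h1 := ih (qhF_mono E 𝒱 P (by omega : j ≤ m) (qh_avg E 𝒱 P (hfac j) w d hw))
          rw [← hQt j w d hw] at h1
          have h2 := Submodule.sub_mem _ (LinearMap.mem_range_self Qt (clProd E 𝒱 0 w)) h1
          simpa using h2
      intro z
      obtain ⟨m, hm⟩ := qhF_exists E 𝒱 P z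
      exact hr m hm
end
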